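/- arXiv:2305.03543 — 3 statements merged into one kernel-verified Lean document; each statement's English description precedes it below -/
import Mathlib

section
/- There exists an absolute constant C > 0 such that for all n ≥ 3, all ε ∈ (0,1/4], and every S_n-invariant family 𝒢 of labeled graphs on vertex set [n] with μ(𝒢) ≥ ε, one has μ(𝒢_T) ≥ 2ε, where T = C·√(n/log n). -/
/-- The probability, under the uniform measure on labeled graphs on `Fin n`
(equivalently under `G(n,1/2)`), of a graph property `P`. -/
noncomputable def graphProb (n : ℕ) (P : SimpleGraph (Fin n) → Prop) : ℝ :=
  (Nat.card {G : SimpleGraph (Fin n) // P G} : ℝ) / 2 ^ n.choose 2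

/-- `deg(v,S)`: the number of neighbors of `v` inside the vertex set `S`. -/
noncomputable def degIn {n : ℕ} (G : SimpleGraph (Fin n)) (v : Fin n)
    (S : Finset (Fin n)) : ℕ :=
  Nat.card {w : Fin n // w ∈ S ∧ G.Adj v w}

/-- `d(G,H) = Δ(G △ H)`: the maximum, over vertices `v`, of the number of vertices `w`
at which the adjacency of `G` and `H` at `{v,w}` differs. -/
noncomputable def maxDegSD {n : ℕ} (G H : SimpleGraph (Fin n)) : ℕ :=
  Finset.univ.sup fun v : Fin n => Nat.card {w : Fin n // ¬ (G.Adj v w ↔ H.Adj v w)}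

open Finset
open scoped symmDiff

section Cube

variable {ι : Type*} [DecidableEq ι]

/-- The Walsh character indexed by `S`, evaluated at the point `A` of the cube `Finset ι`. -/
noncomputable def walsh (S A : Finset ι) : ℝ := (-1) ^ #(S ∩ A)

lemma walsh_comm (S A : Finset ι) : walsh S A = walsh A S := by
  rw [walsh, walsh, inter_comm]

lemma walsh_empty (A : Finset ι) : walsh ∅ A = 1 := by simp [walsh]

lemma walsh_insert_left {e : ι} {S A : Finset ι} (hA : e ∉ A) :
    walsh (insert e S) A = walsh S A := by
  rw [walsh, walsh, insert_inter_of_notMem hA]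

lemma walsh_insert_right {e : ι} {S A : Finset ι} (hS : e ∉ S) :
    walsh S (insert e A) = walsh S A := by
  rw [walsh_comm, walsh_insert_left hS, walsh_comm]

lemma walsh_insert_insert {e : ι} {S A : Finset ι} (hS : e ∉ S) :
    walsh (insert e S) (insert e A) = - walsh S A := by
  rw [walsh, walsh, ← insert_inter_distrib, card_insert_of_notMem (by simp [hS]), pow_succ]
  ring

lemma walsh_symmDiff_singleton (e : ι) (S A : Finset ι) :
    walsh S (A ∆ {e}) = (if e ∈ S then -1 else 1) * walsh S A := by
  have key : ∀ B : Finset ι, e ∉ B →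
      walsh S (insert e B) = (if e ∈ S then -1 else 1) * walsh S B := by
    intro B hB
    split_ifs with h
    · obtain ⟨S', hS', rfl⟩ : ∃ S', e ∉ S' ∧ S = insert e S' :=
        ⟨S.erase e, notMem_erase e S, (insert_erase h).symm⟩
      rw [walsh_insert_insert hS', walsh_insert_left hB, neg_one_mul]
    · rw [walsh_insert_right h, one_mul]
  by_cases hA : e ∈ A
  · obtain ⟨B, hB, rfl⟩ : ∃ B, e ∉ B ∧ A = insert e B :=
      ⟨A.erase e, notMem_erase e A, (insert_erase hA).symm⟩
    have : insert e B ∆ {e} = B := by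
      ext x; simp only [mem_symmDiff, mem_insert, mem_singleton]; grind
    rw [this, key B hB, ← mul_assoc]
    split_ifs <;> simp
  · have : A ∆ {e} = insert e A := by
      ext x; simp only [mem_symmDiff, mem_insert, mem_singleton]; grind
    rw [this, key A hA]

lemma walsh_mul_self (S A : Finset ι) : walsh S A * walsh S A = 1 := by
  rw [walsh, ← pow_add, ← two_mul, pow_mul]; simp

/-- Bonami's `(2, 4)`-hypercontractive inequality on the cube `U.powerset`. -/
lemma sum_walsh_pow_four_le (U : Finset ι) (a : Finset ι → ℝ) :
    ∑ A ∈ U.powerset, (∑ S ∈ U.powerset, a S * walsh S A) ^ 4 ≤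
      2 ^ #U * (∑ S ∈ U.powerset, 3 ^ #S * a S ^ 2) ^ 2 := by
  induction U using Finset.induction_on generalizing a with
  | empty => simp [walsh]; apply le_of_eq; ring
  | insert e U he ih =>
    set q : Finset ι → ℝ := fun A => ∑ S ∈ U.powerset, a S * walsh S A with hq
    set r : Finset ι → ℝ := fun A => ∑ S ∈ U.powerset, a (insert e S) * walsh S A with hr
    have hmem : ∀ A ∈ U.powerset, e ∉ A := fun A hA h => he (mem_powerset.mp hA h)
    have h1 : ∀ A ∈ U.powerset,
        ∑ S ∈ (insert e U).powerset, a S * walsh S A = q A + r A := by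
      intro A hA
      rw [sum_powerset_insert he]
      congr 1
      exact sum_congr rfl fun S _ => by rw [walsh_insert_left (hmem A hA)]
    have h2 : ∀ A ∈ U.powerset,
        ∑ S ∈ (insert e U).powerset, a S * walsh S (insert e A) = q A - r A := by
      intro A hA
      rw [sum_powerset_insert he, sub_eq_add_neg, hr, ← sum_neg_distrib]
      congr 1
      · exact sum_congr rfl fun S hS => by rw [walsh_insert_right (hmem S hS)]
      · exact sum_congr rfl fun S hS => by rw [walsh_insert_insert (hmem S hS), mul_neg]
    have h3 : ∑ S ∈ U.powerset, (3 : ℝ) ^ #(insert e S) * a (insert e S) ^ 2 =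
        3 * ∑ S ∈ U.powerset, 3 ^ #S * a (insert e S) ^ 2 := by
      rw [mul_sum]
      exact sum_congr rfl fun S hS => by
        rw [card_insert_of_notMem (hmem S hS), pow_succ]; ring
    have h4 : ∑ A ∈ (insert e U).powerset, (∑ S ∈ (insert e U).powerset, a S * walsh S A) ^ 4 =
        ∑ A ∈ U.powerset, (q A + r A) ^ 4 + ∑ A ∈ U.powerset, (q A - r A) ^ 4 := by
      rw [sum_powerset_insert he]
      congr 1
      · exact sum_congr rfl fun A hA => by rw [h1 A hA]
      · exact sum_congr rfl fun A hA => by rw [h2 A hA]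
    rw [h4, sum_powerset_insert he, h3, card_insert_of_notMem he]
    have hq4 := ih a
    have hr4 := ih fun S => a (insert e S)
    change ∑ A ∈ U.powerset, q A ^ 4 ≤ _ at hq4
    change ∑ A ∈ U.powerset, r A ^ 4 ≤ _ at hr4
    set X := ∑ S ∈ U.powerset, (3 : ℝ) ^ #S * a S ^ 2
    set Y := ∑ S ∈ U.powerset, (3 : ℝ) ^ #S * a (insert e S) ^ 2
    have hX : 0 ≤ X := sum_nonneg fun S _ => by positivity
    have hY : 0 ≤ Y := sum_nonneg fun S _ => by positivity
    have hcs : (∑ A ∈ U.powerset, q A ^ 2 * r A ^ 2) ^ 2 ≤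
        (∑ A ∈ U.powerset, q A ^ 4) * ∑ A ∈ U.powerset, r A ^ 4 := by
      simpa only [show ∀ x : ℝ, x ^ 4 = (x ^ 2) ^ 2 by intro x; ring] using
        sum_mul_sq_le_sq_mul_sq U.powerset (fun A => q A ^ 2) (fun A => r A ^ 2)
    have hqr : ∑ A ∈ U.powerset, q A ^ 2 * r A ^ 2 ≤ 2 ^ #U * (X * Y) := by
      refine (sq_le_sq₀ (sum_nonneg fun A _ => by positivity) (by positivity)).mp ?_
      calc _ ≤ _ := hcs
        _ ≤ (2 ^ #U * X ^ 2) * (2 ^ #U * Y ^ 2) := by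
          gcongr
        _ = _ := by ring
    have hexp : ∑ A ∈ U.powerset, (q A + r A) ^ 4 + ∑ A ∈ U.powerset, (q A - r A) ^ 4 =
        2 * (∑ A ∈ U.powerset, q A ^ 4) + 12 * (∑ A ∈ U.powerset, q A ^ 2 * r A ^ 2) +
          2 * ∑ A ∈ U.powerset, r A ^ 4 := by
      simp only [mul_sum, ← sum_add_distrib]
      exact sum_congr rfl fun A _ => by ring
    rw [hexp]
    calc _ ≤ 2 * (2 ^ #U * X ^ 2) + 12 * (2 ^ #U * (X * Y)) + 2 * (2 ^ #U * Y ^ 2) := by gcongr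
      _ ≤ 2 * (2 ^ #U * X ^ 2) + 12 * (2 ^ #U * (X * Y)) + 18 * (2 ^ #U * Y ^ 2) := by
        gcongr; norm_num
      _ = _ := by ring

/-- The involution of the cube flipping the coordinate `e`. -/
def flipEquiv (e : ι) : Finset ι ≃ Finset ι :=
  (symmDiff_left_involutive {e}).toPerm

@[simp] lemma flipEquiv_apply (e : ι) (A : Finset ι) : flipEquiv e A = A ∆ {e} := rfl

variable [Fintype ι]

lemma sum_walsh_mul_walsh (S T : Finset ι) :
    ∑ A, walsh S A * walsh T A = if S = T then 2 ^ Fintype.card ι else 0 := by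
  split_ifs with h
  · subst h
    simp [walsh_mul_self]
  · obtain ⟨e, he⟩ : ∃ e, e ∈ S ∆ T := by
      rw [← Finset.Nonempty, nonempty_iff_ne_empty]
      exact fun h0 => h (symmDiff_eq_bot.mp h0)
    have : ∑ A, walsh S A * walsh T A = - ∑ A, walsh S A * walsh T A := by
      nth_rewrite 1 [← Equiv.sum_comp (flipEquiv e)]
      rw [← sum_neg_distrib]
      refine sum_congr rfl fun A _ => ?_
      rw [flipEquiv_apply, walsh_symmDiff_singleton, walsh_symmDiff_singleton]
      rcases mem_symmDiff.mp he with ⟨h1, h2⟩ | ⟨h1, h2⟩ <;> simp [h1, h2]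
    linarith

/-- The Walsh–Fourier coefficient of `f` at `S`. -/
noncomputable def walshCoeff (f : Finset ι → ℝ) (S : Finset ι) : ℝ :=
  (∑ A, f A * walsh S A) / 2 ^ Fintype.card ι

lemma sum_walshCoeff_mul_walsh (f : Finset ι → ℝ) (A : Finset ι) :
    ∑ S, walshCoeff f S * walsh S A = f A := by
  simp only [walshCoeff, div_mul_eq_mul_div, ← sum_div, sum_mul]
  rw [sum_comm]
  have : ∀ B, ∑ S, f B * walsh S B * walsh S A =
      f B * if B = A then 2 ^ Fintype.card ι else 0 := by
    intro B
    rw [← sum_walsh_mul_walsh, mul_sum]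
    exact sum_congr rfl fun S _ => by rw [walsh_comm B, walsh_comm A, mul_assoc]
  simp [this]

lemma sum_mul_sum_walsh (f : Finset ι → ℝ) (a : Finset ι → ℝ) :
    ∑ A, f A * ∑ S, a S * walsh S A =
      2 ^ Fintype.card ι * ∑ S, walshCoeff f S * a S := by
  simp only [walshCoeff, mul_sum]
  rw [sum_comm]
  refine sum_congr rfl fun S _ => ?_
  have : (2 : ℝ) ^ Fintype.card ι ≠ 0 := by positivity
  field_simp
  rw [mul_sum]
  exact sum_congr rfl fun A _ => by ring

lemma sum_sq_eq_sum_walshCoeff_sq (f : Finset ι → ℝ) :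
    ∑ A, f A ^ 2 = 2 ^ Fintype.card ι * ∑ S, walshCoeff f S ^ 2 := by
  have := sum_mul_sum_walsh f (walshCoeff f)
  simp only [sum_walshCoeff_mul_walsh] at this
  simpa only [sq] using this

/-- The dual form of hypercontractivity, with the `L^{4/3}`-norm interpolated between the
`L¹`- and `L²`-norms. -/
lemma sq_sum_walshCoeff_sq_div_le {h : Finset ι → ℝ} {a b : ℝ}
    (ha : ∑ A, |h A| ≤ 2 ^ Fintype.card ι * a) (hb : ∑ A, h A ^ 2 ≤ 2 ^ Fintype.card ι * b) :
    (∑ S, walshCoeff h S ^ 2 / 3 ^ #S) ^ 2 ≤ a ^ 2 * b := by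
  set M : ℝ := 2 ^ Fintype.card ι with hM
  have hM0 : 0 < M := by positivity
  set Q := ∑ S, walshCoeff h S ^ 2 / 3 ^ #S with hQ
  have hQ0 : 0 ≤ Q := sum_nonneg fun S _ => by positivity
  have ha1 : 0 ≤ ∑ A, |h A| := sum_nonneg fun A _ => abs_nonneg _
  have hb1 : 0 ≤ ∑ A, h A ^ 2 := sum_nonneg fun A _ => sq_nonneg _
  have hb0 : 0 ≤ b := nonneg_of_mul_nonneg_right (hb1.trans hb) hM0
  set p : Finset ι → ℝ := fun A => ∑ S, walshCoeff h S / 3 ^ #S * walsh S A with hp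
  have hhp : ∑ A, h A * p A = M * Q := by
    rw [hp, sum_mul_sum_walsh]
    congr 1
    exact sum_congr rfl fun S _ => by ring
  have hp4 : ∑ A, p A ^ 4 ≤ M * Q ^ 2 := by
    have := sum_walsh_pow_four_le univ fun S => walshCoeff h S / 3 ^ #S
    simp only [powerset_univ, card_univ] at this
    have hQ' : ∑ S, 3 ^ #S * (walshCoeff h S / 3 ^ #S) ^ 2 = Q :=
      sum_congr rfl fun S _ => by field_simp
    rwa [hQ'] at this
  have c1 : (M * Q) ^ 2 ≤ (∑ A, |h A|) * ∑ A, |h A| * p A ^ 2 := by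
    rw [← hhp]
    exact sum_sq_le_sum_mul_sum_of_sq_le_mul _ (fun A _ => abs_nonneg _)
      (fun A _ => by positivity) fun A _ => le_of_eq (by rw [mul_pow, ← sq_abs (h A)]; ring)
  have c2 : (∑ A, |h A| * p A ^ 2) ^ 2 ≤ (∑ A, h A ^ 2) * ∑ A, p A ^ 4 := by
    simpa only [show ∀ x : ℝ, x ^ 4 = (x ^ 2) ^ 2 by intro x; ring, sq_abs] using
      sum_mul_sq_le_sq_mul_sq univ (fun A => |h A|) (fun A => p A ^ 2)
  have c3 : (M * Q) ^ 4 ≤ (M * a) ^ 2 * ((M * b) * (M * Q ^ 2)) := by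
    calc (M * Q) ^ 4 = ((M * Q) ^ 2) ^ 2 := by ring
      _ ≤ ((∑ A, |h A|) * ∑ A, |h A| * p A ^ 2) ^ 2 := by gcongr
      _ = (∑ A, |h A|) ^ 2 * (∑ A, |h A| * p A ^ 2) ^ 2 := by ring
      _ ≤ (∑ A, |h A|) ^ 2 * ((∑ A, h A ^ 2) * ∑ A, p A ^ 4) := by gcongr
      _ ≤ _ := by gcongr
  rcases hQ0.eq_or_lt with h0 | h0
  · rw [← h0, zero_pow two_ne_zero]; positivity
  · have hpos : 0 < M ^ 4 * Q ^ 2 := by positivity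
    refine le_of_mul_le_mul_left ?_ hpos
    calc _ = (M * Q) ^ 4 := by ring
      _ ≤ _ := c3
      _ = _ := by ring

lemma walshCoeff_derivative (f : Finset ι → ℝ) (e : ι) (S : Finset ι) :
    walshCoeff (fun A => (f A - f (A ∆ {e})) / 2) S = if e ∈ S then walshCoeff f S else 0 := by
  have h1 : ∑ A, f (A ∆ {e}) * walsh S A = (if e ∈ S then -1 else 1) * ∑ A, f A * walsh S A := by
    rw [← Equiv.sum_comp (flipEquiv e), mul_sum]
    refine sum_congr rfl fun A _ => ?_
    rw [flipEquiv_apply, symmDiff_symmDiff_cancel_right, walsh_symmDiff_singleton]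
    ring
  have h2 : ∑ A, (f A - f (A ∆ {e})) / 2 * walsh S A =
      (∑ A, f A * walsh S A - ∑ A, f (A ∆ {e}) * walsh S A) / 2 := by
    rw [← sum_sub_distrib, sum_div]
    exact sum_congr rfl fun A _ => by ring
  rw [walshCoeff, h2, h1, walshCoeff]
  split_ifs <;> ring

/-- A form of Talagrand's `L¹`–`L²` variance inequality on the cube, for functions whose
discrete derivatives satisfy uniform `L¹` and `L²` bounds. -/
lemma sum_sub_walshCoeff_empty_sq_le {f : Finset ι → ℝ} {a b : ℝ} (ha0 : 0 ≤ a) (hb0 : 0 ≤ b)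
    (ha : ∀ e, ∑ A, |(f A - f (A ∆ {e})) / 2| ≤ 2 ^ Fintype.card ι * a)
    (hb : ∀ e, ∑ A, ((f A - f (A ∆ {e})) / 2) ^ 2 ≤ 2 ^ Fintype.card ι * b)
    {k : ℕ} (hk : 0 < k) :
    ∑ A, (f A - walshCoeff f ∅) ^ 2 ≤
      2 ^ Fintype.card ι * (Fintype.card ι * (3 ^ k * (a * √b) + b / k)) := by
  set M : ℝ := 2 ^ Fintype.card ι with hM
  have hM0 : 0 < M := by positivity
  have hcoeff : ∀ S, walshCoeff (fun A => f A - walshCoeff f ∅) S =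
      if S = ∅ then 0 else walshCoeff f S := by
    intro S
    have h1 := sum_walsh_mul_walsh ∅ S
    simp only [walsh_empty, one_mul] at h1
    rw [walshCoeff]
    simp only [sub_mul, sum_sub_distrib, ← mul_sum, h1, sub_div]
    change walshCoeff f S - _ = _
    by_cases hS : S = ∅
    · subst hS; simp
    · simp [hS, Ne.symm hS]
  have hQ : ∀ e, ∑ S, (if e ∈ S then walshCoeff f S ^ 2 / 3 ^ #S else 0) ≤ a * √b := by
    intro e
    have := sq_sum_walshCoeff_sq_div_le (ha e) (hb e)
    have hQ0 : 0 ≤ ∑ S, (if e ∈ S then walshCoeff f S ^ 2 / 3 ^ #S else 0) :=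
      sum_nonneg fun S _ => by split_ifs <;> positivity
    refine (sq_le_sq₀ hQ0 (by positivity)).mp ?_
    rw [mul_pow, Real.sq_sqrt hb0]
    refine le_trans (le_of_eq ?_) this
    congr 1
    refine sum_congr rfl fun S _ => ?_
    rw [walshCoeff_derivative]
    split_ifs <;> simp
  have hE : ∀ e, ∑ S, (if e ∈ S then walshCoeff f S ^ 2 else 0) ≤ b := by
    intro e
    refine le_of_mul_le_mul_left ?_ hM0
    refine le_trans (le_of_eq ?_) (hb e)
    rw [sum_sq_eq_sum_walshCoeff_sq]
    congr 1
    refine sum_congr rfl fun S _ => ?_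
    rw [walshCoeff_derivative]
    split_ifs <;> simp
  have hcount : ∀ g : Finset ι → ℝ,
      ∑ e, ∑ S, (if e ∈ S then g S else 0) = ∑ S, #S * g S := by
    intro g
    rw [sum_comm]
    refine sum_congr rfl fun S _ => ?_
    simp [sum_ite_mem]
  have hQ' : ∑ S, #S * (walshCoeff f S ^ 2 / 3 ^ #S) ≤ Fintype.card ι * (a * √b) := by
    rw [← hcount]
    refine (sum_le_sum fun e _ => hQ e).trans (le_of_eq ?_)
    simp
  have hE' : ∑ S, #S * walshCoeff f S ^ 2 ≤ Fintype.card ι * b := by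
    rw [← hcount]
    refine (sum_le_sum fun e _ => hE e).trans (le_of_eq ?_)
    simp
  rw [sum_sq_eq_sum_walshCoeff_sq]
  gcongr
  calc ∑ S, walshCoeff (fun A => f A - walshCoeff f ∅) S ^ 2
      ≤ ∑ S, (3 ^ k * (#S * (walshCoeff f S ^ 2 / 3 ^ #S)) + #S * walshCoeff f S ^ 2 / k) := by
        refine sum_le_sum fun S _ => ?_
        rw [hcoeff]
        split_ifs with hS
        · simp [hS]
        · have hk' : (0 : ℝ) < k := by exact_mod_cast hk
          have hc : 1 ≤ #S := Finset.card_pos.mpr (nonempty_iff_ne_empty.mpr hS)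
          have hc' : (1 : ℝ) ≤ #S := by exact_mod_cast hc
          rcases le_total #S k with hle | hle
          · have h3 : (3 : ℝ) ^ #S ≤ 3 ^ k := pow_le_pow_right₀ (by norm_num) hle
            have : walshCoeff f S ^ 2 ≤ 3 ^ k * (#S * (walshCoeff f S ^ 2 / 3 ^ #S)) := by
              calc walshCoeff f S ^ 2 = 3 ^ #S * (1 * (walshCoeff f S ^ 2 / 3 ^ #S)) := by
                    field_simp
                _ ≤ _ := by gcongr
            have : 0 ≤ #S * walshCoeff f S ^ 2 / k := by positivity
            linarith
          · have : walshCoeff f S ^ 2 ≤ #S * walshCoeff f S ^ 2 / k := by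
              rw [le_div_iff₀ hk', mul_comm]
              gcongr
            have : 0 ≤ 3 ^ k * (#S * (walshCoeff f S ^ 2 / 3 ^ #S)) := by positivity
            linarith
    _ = 3 ^ k * (∑ S, #S * (walshCoeff f S ^ 2 / 3 ^ #S)) + (∑ S, #S * walshCoeff f S ^ 2) / k := by
        rw [sum_add_distrib, ← mul_sum, ← sum_div]
    _ ≤ 3 ^ k * (Fintype.card ι * (a * √b)) + Fintype.card ι * b / k := by gcongr
    _ = _ := by ring

end Cube

section Graph

/-- The edges of the complete graph on `V`. -/
abbrev EdgeIndex (V : Type*) := {e : Sym2 V // ¬ e.IsDiag}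

open Classical in
/-- Simple graphs on `V` as points of the cube indexed by the edges of the complete graph. -/
noncomputable def edgeGraph (V : Type*) [Fintype V] : Finset (EdgeIndex V) ≃ SimpleGraph V where
  toFun A := SimpleGraph.fromEdgeSet {e | ∃ h, ⟨e, h⟩ ∈ A}
  invFun G := univ.filter fun e => e.1 ∈ G.edgeSet
  left_inv A := by
    ext ⟨e, he⟩
    simp [he]
  right_inv G := by
    ext v w
    simp only [SimpleGraph.fromEdgeSet_adj, Set.mem_ofPred_eq, mem_filter, mem_univ, true_and,
      SimpleGraph.mem_edgeSet, exists_prop, Sym2.mk_isDiag_iff]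
    exact ⟨fun h => h.1.2, fun h => ⟨⟨h.ne, h⟩, h.ne⟩⟩

/-- The graph obtained from `H` by changing the status of the pair `e`. -/
def flipEdge {V : Type*} (e : Sym2 V) (H : SimpleGraph V) : SimpleGraph V :=
  H ∆ SimpleGraph.fromEdgeSet {e}

lemma flipEdge_adj {V : Type*} {e : Sym2 V} {H : SimpleGraph V} {v w : V} (he : ¬ e.IsDiag) :
    (flipEdge e H).Adj v w ↔ ¬ (H.Adj v w ↔ s(v, w) = e) := by
  have : s(v, w) = e → v ≠ w := by rintro rfl; simpa using he
  simp only [flipEdge, symmDiff_def, SimpleGraph.sup_adj, SimpleGraph.sdiff_adj,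
    SimpleGraph.fromEdgeSet_adj, Set.mem_singleton_iff]
  tauto

lemma edgeGraph_symmDiff_singleton {V : Type*} [Fintype V] [DecidableEq V]
    (A : Finset (EdgeIndex V)) (e : EdgeIndex V) :
    edgeGraph V (A ∆ {e}) = flipEdge e.1 (edgeGraph V A) := by
  ext v w
  rw [flipEdge_adj e.2]
  simp only [edgeGraph, Equiv.coe_fn_mk, SimpleGraph.fromEdgeSet_adj, Set.mem_ofPred_eq,
    mem_symmDiff, mem_singleton, Sym2.mk_isDiag_iff, Subtype.ext_iff]
  have : s(v, w) = e.1 → v ≠ w := by intro h; have := e.2; rw [← h] at this; simpa using this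
  by_cases hvw : v = w
  · tauto
  · simp only [hvw, not_false_eq_true, exists_true_left]
    tauto

lemma flipEdge_map {V : Type*} (σ : Equiv.Perm V) {e : Sym2 V} (he : ¬ e.IsDiag)
    (H : SimpleGraph V) :
    flipEdge (e.map σ) (H.map σ.toEmbedding) = (flipEdge e H).map σ.toEmbedding := by
  have he' : ¬ (e.map σ).IsDiag := by rwa [Sym2.isDiag_map σ.injective]
  ext v w
  obtain ⟨v, rfl⟩ := σ.surjective v
  obtain ⟨w, rfl⟩ := σ.surjective w
  have h1 : ∀ K : SimpleGraph V, (K.map σ.toEmbedding).Adj (σ v) (σ w) ↔ K.Adj v w := fun K =>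
    SimpleGraph.map_adj_apply (f := σ.toEmbedding)
  rw [flipEdge_adj he', h1, h1, flipEdge_adj he, ← Sym2.map_mk,
    (Sym2.map.injective σ.injective).eq_iff]

lemma exists_perm_map_eq {V : Type*} [DecidableEq V] {e e' : Sym2 V} (he : ¬ e.IsDiag)
    (he' : ¬ e'.IsDiag) : ∃ σ : Equiv.Perm V, e.map σ = e' := by
  induction e with | _ a b
  induction e' with | _ c d
  simp only [Sym2.mk_isDiag_iff] at he he'
  refine ⟨(Equiv.swap a c).trans (Equiv.swap (Equiv.swap a c b) d), ?_⟩
  have h1 : Equiv.swap a c b ≠ c := by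
    intro h
    exact he ((Equiv.swap a c).injective (h.trans (Equiv.swap_apply_left a c).symm)).symm
  simp only [Sym2.map_mk, Equiv.trans_apply, Equiv.swap_apply_left]
  rw [Equiv.swap_apply_of_ne_of_ne h1.symm he']

/-- The number of vertices at which the neighbourhoods of `v` in `G` and `H` differ. -/
noncomputable def degSD {n : ℕ} (G H : SimpleGraph (Fin n)) (v : Fin n) : ℕ :=
  Nat.card {w : Fin n // ¬ (G.Adj v w ↔ H.Adj v w)}

variable {n : ℕ}

lemma degSD_self (G : SimpleGraph (Fin n)) (v : Fin n) : degSD G G v = 0 := by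
  simp [degSD]

lemma degSD_map (σ : Equiv.Perm (Fin n)) (G H : SimpleGraph (Fin n)) (v : Fin n) :
    degSD (G.map σ.toEmbedding) (H.map σ.toEmbedding) (σ v) = degSD G H v := by
  refine (Nat.card_congr (σ.subtypeEquiv fun w => ?_)).symm
  have h1 : ∀ K : SimpleGraph (Fin n), (K.map σ.toEmbedding).Adj (σ v) (σ w) ↔ K.Adj v w :=
    fun K => SimpleGraph.map_adj_apply (f := σ.toEmbedding)
  rw [h1, h1]

open Classical in
lemma degSD_flipEdge_le (G H : SimpleGraph (Fin n)) {e : Sym2 (Fin n)} (he : ¬ e.IsDiag)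
    (v : Fin n) : degSD G (flipEdge e H) v ≤ degSD G H v + if v ∈ e then 1 else 0 := by
  change Set.ncard {w | ¬ (G.Adj v w ↔ (flipEdge e H).Adj v w)} ≤
    Set.ncard {w | ¬ (G.Adj v w ↔ H.Adj v w)} + _
  split_ifs with hv
  · obtain ⟨u, rfl⟩ := hv
    refine (Set.ncard_le_ncard (t := insert u {w | ¬ (G.Adj v w ↔ H.Adj v w)}) ?_).trans
      (Set.ncard_insert_le _ _)
    intro w hw
    rw [Set.mem_ofPred_eq, flipEdge_adj he] at hw
    simp only [Set.mem_insert_iff, Set.mem_ofPred_eq]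
    have : s(v, w) = s(v, u) ↔ w = u := Sym2.congr_right
    tauto
  · refine Set.ncard_le_ncard ?_
    intro w hw
    rw [Set.mem_ofPred_eq, flipEdge_adj he] at hw
    rw [Set.mem_ofPred_eq]
    have : s(v, w) ≠ e := by rintro rfl; simp at hv
    tauto

/-- A smooth upper approximation of `maxDegSD`. -/
noncomputable def softMaxDegSD (β : ℝ) (G H : SimpleGraph (Fin n)) : ℝ :=
  Real.log (∑ v, Real.exp (β * degSD G H v)) / β

lemma softMaxDegSD_self (β : ℝ) (G : SimpleGraph (Fin n)) :
    softMaxDegSD β G G = Real.log n / β := by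
  simp [softMaxDegSD, degSD_self]

lemma softMaxDegSD_map (β : ℝ) (σ : Equiv.Perm (Fin n)) (G H : SimpleGraph (Fin n)) :
    softMaxDegSD β (G.map σ.toEmbedding) (H.map σ.toEmbedding) = softMaxDegSD β G H := by
  rw [softMaxDegSD, softMaxDegSD, ← Equiv.sum_comp σ]
  simp only [degSD_map]

lemma maxDegSD_le_softMaxDegSD [NeZero n] {β : ℝ} (hβ : 0 < β) (G H : SimpleGraph (Fin n)) :
    (maxDegSD G H : ℝ) ≤ softMaxDegSD β G H := by
  obtain ⟨v, -, hv⟩ := exists_mem_eq_sup (univ : Finset (Fin n)) univ_nonempty (degSD G H)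
  have hv' : maxDegSD G H = degSD G H v := hv
  rw [hv', softMaxDegSD, le_div_iff₀ hβ, Real.le_log_iff_exp_le
    (sum_pos (fun v _ => Real.exp_pos _) univ_nonempty), mul_comm]
  exact single_le_sum (f := fun v => Real.exp (β * degSD G H v))
    (fun v _ => (Real.exp_pos _).le) (mem_univ v)

open Classical in
lemma exists_softMaxDegSD_flipEdge_le [NeZero n] {β : ℝ} (hβ : 0 < β) (hβ1 : β ≤ 1)
    (G H : SimpleGraph (Fin n)) :
    ∃ p : Fin n → ℝ, (∀ v, 0 ≤ p v) ∧ ∑ v, p v = 1 ∧ ∀ e : Sym2 (Fin n), ¬ e.IsDiag →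
      softMaxDegSD β G (flipEdge e H) ≤ softMaxDegSD β G H + 2 * ∑ v with v ∈ e, p v := by
  set w : Fin n → ℝ := fun v => Real.exp (β * degSD G H v)
  have hw : ∀ v, 0 < w v := fun v => Real.exp_pos _
  set Z := ∑ v, w v with hZ
  have hZ0 : 0 < Z := sum_pos (fun v _ => hw v) univ_nonempty
  refine ⟨fun v => w v / Z, fun v => (div_pos (hw v) hZ0).le, ?_, fun e he => ?_⟩
  · rw [← sum_div, div_self hZ0.ne']
  have hexp : Real.exp β - 1 ≤ 2 * β := by
    have := Real.abs_exp_sub_one_le (x := β) (by rwa [abs_of_pos hβ])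
    rw [abs_of_pos hβ] at this
    exact (le_abs_self _).trans this
  have h1 : ∀ v, Real.exp (β * degSD G (flipEdge e H) v) ≤
      w v + 2 * β * if v ∈ e then w v else 0 := by
    intro v
    have h2 : (degSD G (flipEdge e H) v : ℝ) ≤ degSD G H v + if v ∈ e then 1 else 0 := by
      exact_mod_cast degSD_flipEdge_le G H he v
    calc _ ≤ Real.exp (β * (degSD G H v + if v ∈ e then 1 else 0)) := by gcongr
      _ = w v * Real.exp (β * if v ∈ e then 1 else 0) := by rw [mul_add, Real.exp_add]
      _ ≤ _ := by
        split_ifs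
        · rw [mul_one]; nlinarith [hw v]
        · simp
  have h2 : ∑ v, Real.exp (β * degSD G (flipEdge e H) v) ≤
      Z * (1 + β * (2 * ∑ v with v ∈ e, w v / Z)) := by
    calc _ ≤ ∑ v, (w v + 2 * β * if v ∈ e then w v else 0) := sum_le_sum fun v _ => h1 v
      _ = _ := by
        rw [sum_add_distrib, ← mul_sum, ← sum_filter, ← sum_div, ← hZ]
        field_simp
  have h3 : 0 ≤ ∑ v with v ∈ e, w v / Z := sum_nonneg fun v _ => (div_pos (hw v) hZ0).le
  rw [softMaxDegSD, softMaxDegSD, div_add' _ _ _ hβ.ne']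
  gcongr
  calc _ ≤ Real.log (Z * (1 + β * (2 * ∑ v with v ∈ e, w v / Z))) :=
        Real.log_le_log (sum_pos (fun v _ => Real.exp_pos _) univ_nonempty) h2
    _ = Real.log Z + Real.log (1 + β * (2 * ∑ v with v ∈ e, w v / Z)) :=
        Real.log_mul hZ0.ne' (by positivity)
    _ ≤ _ := by
      gcongr
      have := Real.log_le_sub_one_of_pos (x := 1 + β * (2 * ∑ v with v ∈ e, w v / Z))
        (by positivity)
      linarith

open Classical in
lemma sum_edgeIndex_sum_le (p : Fin n → ℝ) (hp : ∀ v, 0 ≤ p v) :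
    ∑ e : EdgeIndex (Fin n), ∑ v with v ∈ e.1, p v ≤ n * ∑ v, p v := by
  simp only [sum_filter]
  rw [sum_comm, mul_sum]
  refine sum_le_sum fun v _ => ?_
  rw [← sum_filter, sum_const, nsmul_eq_mul]
  gcongr
  · exact hp v
  have hsub : (univ.filter fun e : EdgeIndex (Fin n) => v ∈ e.1).map (Function.Embedding.subtype _)
      ⊆ univ.image fun w => s(v, w) := by
    intro e he
    simp only [mem_map, mem_filter, mem_univ, true_and] at he
    obtain ⟨⟨e, he'⟩, ⟨w, rfl⟩, rfl⟩ := he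
    simp
  have := (card_le_card hsub).trans card_image_le
  simpa using this

/-- Relabelling invariance makes every statistic of a discrete derivative independent of the
edge. -/
lemma sum_derivative_eq_of_invariant {g : SimpleGraph (Fin n) → ℝ}
    (hg : ∀ (σ : Equiv.Perm (Fin n)) H, g (H.map σ.toEmbedding) = g H) (φ : ℝ → ℝ)
    (e e' : EdgeIndex (Fin n)) :
    ∑ A, φ (g (edgeGraph _ A) - g (edgeGraph _ (A ∆ {e}))) =
      ∑ A, φ (g (edgeGraph _ A) - g (edgeGraph _ (A ∆ {e'}))) := by
  classical
  simp only [edgeGraph_symmDiff_singleton]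
  obtain ⟨σ, hσ⟩ := exists_perm_map_eq e.2 e'.2
  let τ : SimpleGraph (Fin n) ≃ SimpleGraph (Fin n) :=
    { toFun := fun H => H.map σ.toEmbedding
      invFun := fun H => H.comap σ.toEmbedding
      left_inv := fun H => SimpleGraph.comap_map_eq σ.toEmbedding H
      right_inv := fun H => by
        change (H.comap σ.toEmbedding).map σ.toEmbedding = H
        rw [← SimpleGraph.comap_symm]
        ext; simp }
  rw [Equiv.sum_comp (edgeGraph (Fin n)) fun H => φ (g H - g (flipEdge e.1 H)),
    Equiv.sum_comp (edgeGraph (Fin n)) fun H => φ (g H - g (flipEdge e'.1 H)),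
    ← Equiv.sum_comp τ fun H => φ (g H - g (flipEdge e'.1 H))]
  refine sum_congr rfl fun H _ => ?_
  change _ = φ (g (H.map σ.toEmbedding) - g (flipEdge e'.1 (H.map σ.toEmbedding)))
  rw [← hσ, flipEdge_map σ e.2, hg, hg]

open Classical in
/-- The variance bound for a relabelling-invariant function whose upward increments vanish
outside a set of density `δ` and are dominated there by a probability vector on the vertices. -/
lemma sum_sub_sq_le_of_invariant (hn : 3 ≤ n) {g : SimpleGraph (Fin n) → ℝ}
    (hg : ∀ (σ : Equiv.Perm (Fin n)) H, g (H.map σ.toEmbedding) = g H)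
    {S : Finset (Finset (EdgeIndex (Fin n)))} {δ : ℝ}
    (hS : (#S : ℝ) ≤ δ * 2 ^ Fintype.card (EdgeIndex (Fin n)))
    (hmax : ∀ A ∉ S, ∀ H, g H ≤ g (edgeGraph _ A))
    (hgrad : ∀ A ∈ S, ∃ p : Fin n → ℝ, (∀ v, 0 ≤ p v) ∧ ∑ v, p v = 1 ∧
      ∀ e : Sym2 (Fin n), ¬ e.IsDiag →
        g (flipEdge e (edgeGraph _ A)) ≤ g (edgeGraph _ A) + 2 * ∑ v with v ∈ e, p v)
    {k : ℕ} (hk : 0 < k) :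
    ∃ m, ∑ A, (g (edgeGraph _ A) - m) ^ 2 ≤ 2 ^ Fintype.card (EdgeIndex (Fin n)) *
      (n ^ 2 / 2 * (3 ^ k * (6 * δ / n * √(6 * δ / n)) + 6 * δ / n / k)) := by
  set N := Fintype.card (EdgeIndex (Fin n)) with hN
  set M : ℝ := 2 ^ N with hM
  have hM0 : 0 < M := by positivity
  have hn' : (3 : ℝ) ≤ n := by exact_mod_cast hn
  have hδ : 0 ≤ δ := nonneg_of_mul_nonneg_left ((Nat.cast_nonneg _).trans hS) hM0
  have hNr : (N : ℝ) = n * (n - 1) / 2 := by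
    rw [hN, Sym2.card_subtype_not_diag, Fintype.card_fin, Nat.cast_choose_two]
  have hNle : (N : ℝ) ≤ n ^ 2 / 2 := by rw [hNr]; nlinarith
  have hNge : (n : ℝ) ^ 2 / 3 ≤ N := by rw [hNr]; nlinarith
  have hN0 : (0 : ℝ) < N := lt_of_lt_of_le (by positivity) hNge
  set F : Finset (EdgeIndex (Fin n)) → ℝ := fun A => g (edgeGraph _ A) with hF
  set u : EdgeIndex (Fin n) → Finset (EdgeIndex (Fin n)) → ℝ :=
    fun e A => max (F (A ∆ {e}) - F A) 0 with hu
  have hu0 : ∀ e A, 0 ≤ u e A := fun e A => le_max_right _ _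
  have hflip : ∀ e (φ : Finset (EdgeIndex (Fin n)) → ℝ), ∑ A, φ (A ∆ {e}) = ∑ A, φ A :=
    fun e φ => Equiv.sum_comp (flipEquiv e) φ
  have husum : ∑ e, ∑ A, u e A ≤ 2 * n * #S := by
    rw [sum_comm, ← sum_subset (subset_univ S)]
    · rw [mul_comm, ← nsmul_eq_mul]
      refine sum_le_card_nsmul _ _ _ fun A hA => ?_
      obtain ⟨p, hp0, hp1, hp⟩ := hgrad A hA
      calc ∑ e, u e A ≤ ∑ e : EdgeIndex (Fin n), 2 * ∑ v with v ∈ e.1, p v := by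
            refine sum_le_sum fun e _ => max_le ?_ ?_
            · have := hp e.1 e.2
              rw [← edgeGraph_symmDiff_singleton] at this
              simp only [hF]
              linarith
            · exact mul_nonneg zero_le_two (sum_nonneg fun v _ => hp0 v)
        _ ≤ 2 * (n * ∑ v, p v) := by
            rw [← mul_sum]
            gcongr
            exact sum_edgeIndex_sum_le p hp0
        _ = _ := by rw [hp1]; ring
    · intro A _ hA
      exact sum_eq_zero fun e _ => max_eq_right (by linarith [hmax A hA (edgeGraph _ (A ∆ {e}))])
  have hule : ∀ e A, u e A ≤ 2 := by
    intro e A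
    refine max_le ?_ zero_le_two
    by_cases hA : A ∈ S
    · obtain ⟨p, hp0, hp1, hp⟩ := hgrad A hA
      have h1 := hp e.1 e.2
      rw [← edgeGraph_symmDiff_singleton] at h1
      have h2 : ∑ v with v ∈ e.1, p v ≤ 1 := by
        rw [← hp1]
        exact sum_le_sum_of_subset_of_nonneg (filter_subset _ _) fun v _ _ => hp0 v
      simp only [hF]
      linarith
    · linarith [hmax A hA (edgeGraph _ (A ∆ {e}))]
  have habs : ∀ e, ∑ A, |(F A - F (A ∆ {e})) / 2| = ∑ A, u e A := by
    intro e
    have h1 : ∀ A, |(F A - F (A ∆ {e})) / 2| = (u e A + u e (A ∆ {e})) / 2 := by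
      intro A
      simp only [hu, symmDiff_symmDiff_cancel_right, abs_div, abs_two]
      rcases le_total (F A) (F (A ∆ {e})) with h | h
      · rw [abs_of_nonpos (by linarith), max_eq_left (by linarith), max_eq_right (by linarith)]
        ring
      · rw [abs_of_nonneg (by linarith), max_eq_right (by linarith), max_eq_left (by linarith)]
        ring
    simp only [h1, ← sum_div, sum_add_distrib, hflip e (u e)]
    ring
  have hsq : ∀ e, ∑ A, ((F A - F (A ∆ {e})) / 2) ^ 2 ≤ ∑ A, |(F A - F (A ∆ {e})) / 2| := by
    intro e
    refine sum_le_sum fun A _ => ?_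
    rw [← sq_abs]
    have h1 : |(F A - F (A ∆ {e})) / 2| ≤ 1 := by
      have h2 := hule e A
      have h3 := hule e (A ∆ {e})
      simp only [hu, symmDiff_symmDiff_cancel_right, max_le_iff] at h2 h3
      rw [abs_le]
      constructor <;> linarith [h2.1, h3.1]
    nlinarith [abs_nonneg ((F A - F (A ∆ {e})) / 2)]
  have hL1 : ∀ e, ∑ A, |(F A - F (A ∆ {e})) / 2| ≤ M * (6 * δ / n) := by
    intro e
    have hcard : N * ∑ A, |(F A - F (A ∆ {e})) / 2| ≤ 2 * n * #S := by
      refine le_trans (le_of_eq ?_) husum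
      simp only [← habs]
      rw [sum_congr rfl fun e' _ => sum_derivative_eq_of_invariant hg (fun x => |x / 2|) e' e]
      simp [hN, hF]
    have h0 : 0 ≤ ∑ A, |(F A - F (A ∆ {e})) / 2| := sum_nonneg fun A _ => abs_nonneg _
    have h1 : (n : ℝ) ^ 2 / 3 * ∑ A, |(F A - F (A ∆ {e})) / 2| ≤
        n ^ 2 / 3 * (M * (6 * δ / n)) := by
      calc _ ≤ N * ∑ A, |(F A - F (A ∆ {e})) / 2| := by gcongr
        _ ≤ 2 * n * (δ * M) := hcard.trans (by gcongr)
        _ = _ := by field_simp; ring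
    exact le_of_mul_le_mul_left h1 (by positivity)
  refine ⟨walshCoeff F ∅, ?_⟩
  refine (sum_sub_walshCoeff_empty_sq_le (a := 6 * δ / n) (b := 6 * δ / n) (by positivity)
    (by positivity) hL1 (fun e => (hsq e).trans (hL1 e)) hk).trans ?_
  gcongr

lemma graphProb_eq (P : SimpleGraph (Fin n) → Prop) [DecidablePred fun A => P (edgeGraph _ A)] :
    graphProb n P = #{A | P (edgeGraph _ A)} / 2 ^ Fintype.card (EdgeIndex (Fin n)) := by
  classical
  rw [graphProb, Sym2.card_subtype_not_diag, Fintype.card_fin,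
    Nat.card_congr ((edgeGraph (Fin n)).subtypeEquiv fun A => Iff.rfl).symm,
    Nat.card_eq_fintype_card, Fintype.card_subtype]

end Graph

lemma exists_level_bound {x : ℝ} (hx : 3 ≤ x) :
    ∃ k : ℕ, 0 < k ∧ 3 ^ k * (12 * √x) + 6 * x / k ≤ 240 * (x / Real.log x) := by
  set L := Real.log x with hL
  have hx0 : 0 < x := by linarith
  have hL0 : 0 < L := Real.log_pos (by linarith)
  have hxL : x = Real.exp L := (Real.exp_log hx0).symm
  have h3 : (3 : ℝ) ≤ Real.exp (4 / 3) := by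
    rw [show (4 : ℝ) / 3 = 1 + 1 / 3 by norm_num, Real.exp_add]
    have := Real.exp_one_gt_d9
    have := Real.add_one_le_exp (1 / 3 : ℝ)
    nlinarith
  refine ⟨⌊L / 4⌋₊ + 1, Nat.succ_pos _, ?_⟩
  have hk1 : (⌊L / 4⌋₊ : ℝ) ≤ L / 4 := Nat.floor_le (by positivity)
  have hk2 : L / 4 ≤ ((⌊L / 4⌋₊ + 1 : ℕ) : ℝ) := by
    push_cast; exact (Nat.lt_floor_add_one _).le
  have hpow : (3 : ℝ) ^ (⌊L / 4⌋₊ + 1) ≤ 3 * Real.exp (L / 3) := by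
    rw [pow_succ, mul_comm]
    gcongr
    calc (3 : ℝ) ^ ⌊L / 4⌋₊ ≤ Real.exp (4 / 3) ^ ⌊L / 4⌋₊ := by gcongr
      _ = Real.exp (⌊L / 4⌋₊ * (4 / 3)) := by rw [← Real.exp_nat_mul]
      _ ≤ _ := by gcongr; linarith
  have hsqrt : √x = Real.exp (L / 2) := by
    rw [Real.sqrt_eq_iff_mul_self_eq hx0.le (Real.exp_pos _).le, ← Real.exp_add, add_halves, ← hxL]
  have h6 : Real.exp (L / 3) * Real.exp (L / 2) ≤ 6 * (x / L) := by
    rw [← mul_div_assoc, le_div_iff₀ hL0, hxL, ← Real.exp_add]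
    have h7 : Real.exp L = Real.exp (L / 3 + L / 2) * Real.exp (L / 6) := by
      rw [← Real.exp_add]; ring_nf
    have h8 : L ≤ 6 * Real.exp (L / 6) := by linarith [Real.add_one_le_exp (L / 6)]
    rw [h7]
    nlinarith [Real.exp_pos (L / 3 + L / 2)]
  calc _ ≤ 3 * Real.exp (L / 3) * (12 * Real.exp (L / 2)) + 6 * x / (L / 4) := by
        rw [hsqrt]; gcongr
    _ = 36 * (Real.exp (L / 3) * Real.exp (L / 2)) + 24 * (x / L) := by field_simp; ring
    _ ≤ 36 * (6 * (x / L)) + 24 * (x / L) := by gcongr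
    _ = _ := by ring

lemma log_le_six_mul_sqrt {x : ℝ} (hx : 3 ≤ x) : Real.log x ≤ 6 * √(x / Real.log x) := by
  have hx0 : 0 < x := by linarith
  have hL0 : 0 < Real.log x := Real.log_pos (by linarith)
  set L := Real.log x with hL
  have hxL : x = Real.exp (L / 3) ^ 3 := by
    rw [← Real.exp_nat_mul, Nat.cast_ofNat, mul_div_cancel₀ _ (by norm_num), Real.exp_log hx0]
  have h1 : L / 3 ≤ Real.exp (L / 3) := by linarith [Real.add_one_le_exp (L / 3)]
  have h2 : (L / 3) ^ 3 ≤ x := by rw [hxL]; gcongr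
  have h3 : (L / 6) ^ 2 ≤ x / L := by
    rw [le_div_iff₀ hL0]
    nlinarith [pow_pos hL0 3]
  have h4 := Real.le_sqrt_of_sq_le h3
  linarith

/-- There is an absolute constant `C > 0` such that for all `n ≥ 3`,
`ε ∈ (0,1/4]`, and every `Sₙ`-invariant family `𝒢` of graphs on `[n]` with `μ(𝒢) ≥ ε`:
`μ(𝒢_T) ≥ 2ε` with `T = C·√(n/log n)`. -/
theorem symmetric_family_density_doubling :
    ∃ C : ℝ, 0 < C ∧
      ∀ n : ℕ, 3 ≤ n → ∀ ε : ℝ, 0 < ε → ε ≤ 1 / 4 →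
        ∀ 𝒢 : Set (SimpleGraph (Fin n)),
          (∀ σ : Equiv.Perm (Fin n), ∀ G ∈ 𝒢, G.map σ.toEmbedding ∈ 𝒢) →
          ε ≤ graphProb n (fun G => G ∈ 𝒢) →
          2 * ε ≤ graphProb n (fun H => ∃ G ∈ 𝒢,
            (maxDegSD G H : ℝ) ≤ C * Real.sqrt (n / Real.log n)) := by
  classical
  refine ⟨42, by norm_num, fun n hn ε hε hε4 𝒢 hinv hμ => ?_⟩
  by_contra! hcon
  have : NeZero n := ⟨by omega⟩
  have hn' : (3 : ℝ) ≤ n := by exact_mod_cast hn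
  have hn0 : (0 : ℝ) < n := by linarith
  set L := Real.log n with hL
  have hL0 : 0 < L := Real.log_pos (by linarith)
  set T : ℝ := 6 * √(n / L) with hT
  have hT0 : 0 < T := by positivity
  have hTsq : T ^ 2 = 36 * (n / L) := by
    rw [hT, mul_pow, Real.sq_sqrt (by positivity)]; norm_num
  set β : ℝ := L / T with hβ
  have hβ0 : 0 < β := by positivity
  have hβ1 : β ≤ 1 := (div_le_one hT0).mpr (log_le_six_mul_sqrt hn')
  have hLβ : L / β = T := by rw [hβ]; field_simp
  rw [graphProb_eq] at hμ hcon
  set N := Fintype.card (EdgeIndex (Fin n)) with hN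
  set M : ℝ := 2 ^ N with hM
  have hM0 : 0 < M := by positivity
  rw [le_div_iff₀ hM0] at hμ
  rw [div_lt_iff₀ hM0] at hcon
  have hne : Nonempty 𝒢 := by
    by_contra h0
    have h1 : ∀ H, H ∉ 𝒢 := fun H hH => h0 ⟨H, hH⟩
    simp only [h1, filter_false, card_empty, Nat.cast_zero] at hμ
    linarith [mul_pos hε hM0]
  set f : SimpleGraph (Fin n) → ℝ := fun H => ⨅ G : 𝒢, softMaxDegSD β G.1 H with hf
  have hfle : ∀ (G : 𝒢) H, f H ≤ softMaxDegSD β G.1 H := fun G H =>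
    ciInf_le (Set.finite_range _).bddBelow G
  have hfex : ∀ H, ∃ G : 𝒢, softMaxDegSD β G.1 H = f H := fun H => exists_eq_ciInf_of_finite
  have hfmap_le : ∀ (σ : Equiv.Perm (Fin n)) H, f (H.map σ.toEmbedding) ≤ f H := by
    intro σ H
    obtain ⟨G, hG⟩ := hfex H
    rw [← hG, ← softMaxDegSD_map β σ]
    exact hfle ⟨_, hinv σ _ G.2⟩ _
  have hfmap : ∀ (σ : Equiv.Perm (Fin n)) H, f (H.map σ.toEmbedding) = f H := by
    intro σ H
    refine le_antisymm (hfmap_le σ H) ?_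
    have h1 := hfmap_le σ.symm (H.map σ.toEmbedding)
    rwa [SimpleGraph.map_symm, SimpleGraph.comap_map_eq] at h1
  set g : SimpleGraph (Fin n) → ℝ := fun H => min (f H) (7 * T) with hg
  have hgmap : ∀ (σ : Equiv.Perm (Fin n)) H, g (H.map σ.toEmbedding) = g H := fun σ H => by
    simp only [hg, hfmap]
  set S : Finset (Finset (EdgeIndex (Fin n))) := {A | f (edgeGraph _ A) < 7 * T} with hS
  have hSlt : (#S : ℝ) < 2 * ε * M := by
    refine lt_of_le_of_lt ?_ hcon
    norm_cast
    refine card_le_card fun A hA => ?_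
    simp only [hS, mem_filter, mem_univ, true_and] at hA ⊢
    obtain ⟨G, hG⟩ := hfex (edgeGraph _ A)
    refine ⟨G.1, G.2, (maxDegSD_le_softMaxDegSD hβ0 _ _).trans ?_⟩
    rw [hG]
    linarith
  have hgS : ∀ A ∉ S, g (edgeGraph _ A) = 7 * T := fun A hA => by
    simp only [hS, mem_filter, mem_univ, true_and, not_lt] at hA
    exact min_eq_right hA
  have hg𝒢 : ∀ A, edgeGraph _ A ∈ 𝒢 → g (edgeGraph _ A) ≤ T := fun A hA =>
    (min_le_left _ _).trans <| (hfle ⟨_, hA⟩ _).trans (by rw [softMaxDegSD_self, hLβ])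
  obtain ⟨k, hk0, hk⟩ := exists_level_bound hn'
  obtain ⟨m, hm⟩ := sum_sub_sq_le_of_invariant hn hgmap hSlt.le
    (fun A hA H => (min_le_right _ _).trans (hgS A hA).ge) (fun A hA => by
      obtain ⟨G, hG⟩ := hfex (edgeGraph _ A)
      obtain ⟨p, hp0, hp1, hp⟩ := exists_softMaxDegSD_flipEdge_le hβ0 hβ1 G.1 (edgeGraph _ A)
      refine ⟨p, hp0, hp1, fun e he => (min_le_left _ _).trans ((hfle G _).trans ?_)⟩
      simp only [hS, mem_filter, mem_univ, true_and] at hA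
      rw [hg]
      beta_reduce
      rw [min_eq_left hA.le, ← hG]
      exact hp e he) hk0
  have hlower : ε * M * (9 * T ^ 2) ≤ ∑ A, (g (edgeGraph _ A) - m) ^ 2 := by
    have key : ∀ B : Finset (Finset (EdgeIndex (Fin n))), ε * M ≤ #B →
        (∀ A ∈ B, 9 * T ^ 2 ≤ (g (edgeGraph _ A) - m) ^ 2) →
        ε * M * (9 * T ^ 2) ≤ ∑ A, (g (edgeGraph _ A) - m) ^ 2 := by
      intro B hB hBm
      calc ε * M * (9 * T ^ 2) ≤ #B * (9 * T ^ 2) := by gcongr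
        _ ≤ ∑ A ∈ B, (g (edgeGraph _ A) - m) ^ 2 := by
          rw [← nsmul_eq_mul]; exact card_nsmul_le_sum _ _ _ hBm
        _ ≤ _ := sum_le_sum_of_subset_of_nonneg (subset_univ B) fun A _ _ => sq_nonneg _
    rcases le_total (4 * T) m with h | h
    · refine key {A | edgeGraph _ A ∈ 𝒢} hμ fun A hA => ?_
      have := hg𝒢 A (by simpa using hA)
      nlinarith
    · refine key Sᶜ ?_ fun A hA => ?_
      · have h1 : (#Sᶜ : ℝ) + #S = M := by
          rw [hM, hN, ← Nat.cast_ofNat, ← Nat.cast_pow, ← Fintype.card_finset]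
          exact_mod_cast card_compl_add_card S
        nlinarith
      · rw [hgS A (by simpa using hA)]
        nlinarith
  have hsqrt : √(6 * (2 * ε) / n) ≤ 2 * √n / n := by
    refine Real.sqrt_le_iff.mpr ⟨by positivity, ?_⟩
    rw [div_pow, mul_pow, Real.sq_sqrt hn0.le, div_le_div_iff₀ hn0 (by positivity)]
    nlinarith [sq_nonneg (n : ℝ), pow_pos hn0 2]
  have hupper : ε * M * (9 * T ^ 2) ≤ ε * M * (240 * (n / L)) := by
    refine hlower.trans (hm.trans ?_)
    calc _ ≤ M * (n ^ 2 / 2 * (3 ^ k * (6 * (2 * ε) / n * (2 * √n / n)) +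
          6 * (2 * ε) / n / k)) := by gcongr
      _ = ε * M * (3 ^ k * (12 * √n) + 6 * n / k) := by field_simp; ring
      _ ≤ _ := by gcongr
  have h1 := le_of_mul_le_mul_left hupper (mul_pos hε hM0)
  rw [hTsq] at h1
  linarith [div_pos hn0 hL0]
end

section
/- There exist an absolute constant c > 0 and an absolute constant n_0 such that the following holds for all n ≥ n_0, all ε ∈ (0,1/4], and every f : {0,1}^{C(n,2)} → {0,1} whose coordinates are indexed by the edge slots of graphs on [n] and which is invariant under the induced S_n-action, with E[f] ∈ [ε, 1−ε] (x uniform): at least one of the following holds. (Inf1) P[s_f^+(x) > 0] ≥ c·ε·√(log n / n). (Inf2) There is an integer j ∈ [⌊(log_2 n)/2⌋, ⌊log_2 C(n,2)⌋] such that 2^j · P[s_f^+(x) ∈ [2^j, 2^{j+1}]] ≥ c·ε·√n·(log n)^5. (Inf3) There are integers ℓ ∈ [2, log* n − 1] and j ∈ [⌊log_2 n + 30·log^{(ℓ+1)} n⌋, ⌊log_2 n + 30·log^{(ℓ)} n⌋] such that 2^{j/2} · P[s_f^+(x) ∈ [2^j, 2^{j+1}]] ≥ c·ε·√(log n)/(log^{(ℓ)}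 n)². -/
/-- The `k`-fold iterated natural logarithm. -/
noncomputable def iterLog : ℕ → ℝ → ℝ
  | 0, x => x
  | k + 1, x => Real.log (iterLog k x)

/-- `log* x`: the least nonnegative integer `k` with `log^{(k)} x ∈ [1, e)`. -/
noncomputable def logStar (x : ℝ) : ℕ :=
  sInf {k : ℕ | iterLog k x ∈ Set.Ico 1 (Real.exp 1)}

/-- The positive sensitivity of a Boolean graph function at `G`: `0` if `f G = 1`, and
otherwise the number of (non-diagonal) edge slots whose flip makes `f` equal `1`. -/
noncomputable def gPosSens {n : ℕ} (f : SimpleGraph (Fin n) → Bool)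
    (G : SimpleGraph (Fin n)) : ℕ :=
  if f G then 0
  else Nat.card {p : Sym2 (Fin n) // ¬ p.IsDiag ∧
    f (SimpleGraph.fromEdgeSet (symmDiff G.edgeSet {p})) = true}


namespace BoolCube

open Finset
open scoped BigOperators

section Fourier

set_option linter.unusedSectionVars false

variable {ι : Type*} [Fintype ι] [DecidableEq ι]

/-- The `±1` value of a bit. -/
def sgn (b : Bool) : ℝ := if b then -1 else 1

@[simp] lemma sgn_not (b : Bool) : sgn (!b) = -sgn b := by cases b <;> simp [sgn]

lemma sgn_mul_self (b : Bool) : sgn b * sgn b = 1 := by cases b <;> simp [sgn]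

lemma sgn_mul_sgn_eq (a b : Bool) : sgn a * sgn b = 1 ∨ sgn a * sgn b = -1 := by
  cases a <;> cases b <;> simp [sgn]

/-- Flip the `i`-th bit. -/
def flip (i : ι) (x : ι → Bool) : ι → Bool := Function.update x i (!x i)

@[simp] lemma flip_self (i : ι) (x : ι → Bool) : flip i x i = !x i := by simp [flip]

lemma flip_of_ne {i j : ι} (h : j ≠ i) (x : ι → Bool) : flip i x j = x j := by simp [flip, h]

@[simp] lemma flip_flip (i : ι) (x : ι → Bool) : flip i (flip i x) = x := by
  ext j
  by_cases h : j = i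
  · subst h; simp
  · simp [flip_of_ne h]

lemma expect_flip (i : ι) (g : (ι → Bool) → ℝ) : 𝔼 x, g (flip i x) = 𝔼 x, g x :=
  Fintype.expect_equiv (Function.Involutive.toPerm (flip i) (flip_flip i)) _ _ fun _ => rfl

lemma expect_eq_zero_of_flip (i : ι) (g : (ι → Bool) → ℝ) (h : ∀ x, g (flip i x) = -g x) :
    𝔼 x, g x = 0 := by
  have h1 := expect_flip i g
  simp only [h, expect_neg_distrib] at h1
  linarith

/-- The Walsh character of a set of coordinates. -/
def chi (S : Finset ι) (x : ι → Bool) : ℝ := ∏ i ∈ S, sgn (x i)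

lemma chi_flip (S : Finset ι) (i : ι) (x : ι → Bool) :
    chi S (flip i x) = (if i ∈ S then -1 else 1) * chi S x := by
  unfold chi
  split_ifs with h
  · rw [← mul_prod_erase _ _ h, ← mul_prod_erase _ (fun i => sgn (x i)) h]
    rw [prod_congr rfl fun j hj => by rw [flip_of_ne (ne_of_mem_erase hj)]]
    simp
  · rw [one_mul]
    exact prod_congr rfl fun j hj => by rw [flip_of_ne (by rintro rfl; exact h hj)]

/-- The Fourier–Walsh coefficient. -/
noncomputable def coeff (f : (ι → Bool) → ℝ) (S : Finset ι) : ℝ := 𝔼 x, f x * chi S x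

/-- The noise kernel. -/
noncomputable def kernel (ρ : ℝ) (x y : ι → Bool) : ℝ := ∏ i, (1 + ρ * (sgn (x i) * sgn (y i)))

/-- The noise operator. -/
noncomputable def noise (ρ : ℝ) (f : (ι → Bool) → ℝ) (x : ι → Bool) : ℝ :=
  𝔼 y, f y * kernel ρ x y

/-- The part of `f` that depends on the `i`-th coordinate. -/
noncomputable def lap (i : ι) (f : (ι → Bool) → ℝ) (x : ι → Bool) : ℝ :=
  (f x - f (flip i x)) / 2

lemma kernel_eq_sum (ρ : ℝ) (x y : ι → Bool) :
    kernel ρ x y = ∑ S : Finset ι, ρ ^ #S * (chi S x * chi S y) := by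
  unfold kernel
  rw [prod_one_add, powerset_univ]
  simp [prod_mul_distrib, chi]

lemma noise_eq_sum (ρ : ℝ) (f : (ι → Bool) → ℝ) (x : ι → Bool) :
    noise ρ f x = ∑ S : Finset ι, ρ ^ #S * coeff f S * chi S x := by
  unfold noise coeff
  simp_rw [kernel_eq_sum, mul_sum, expect_sum_comm, mul_expect, expect_mul]
  exact sum_congr rfl fun S _ => expect_congr rfl fun y _ => by ring

lemma expect_prod (h : ι → Bool → ℝ) :
    𝔼 y : ι → Bool, ∏ i, h i (y i) = ∏ i, ((h i true + h i false) / 2) := by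
  have := prod_univ_sum (fun _ : ι => (univ : Finset Bool)) h
  rw [Fintype.piFinset_univ] at this
  rw [Fintype.expect_eq_sum_div_card, ← this]
  simp [prod_div_distrib]

lemma expect_kernel (ρ : ℝ) (x : ι → Bool) : 𝔼 y, kernel ρ x y = 1 := by
  unfold kernel
  rw [expect_prod fun i b => 1 + ρ * (sgn (x i) * sgn b)]
  refine prod_eq_one fun i _ => ?_
  simp [sgn]
  ring

lemma noise_one (f : (ι → Bool) → ℝ) (x : ι → Bool) : noise 1 f x = f x := by
  have hne : ∀ y, y ≠ x → f y * kernel 1 x y = 0 := by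
    intro y hy
    obtain ⟨i, hi⟩ := Function.ne_iff.1 hy
    refine mul_eq_zero_of_right _ (prod_eq_zero (mem_univ i) ?_)
    revert hi
    cases x i <;> cases y i <;> simp [sgn]
  have hx : kernel 1 x x = 2 ^ Fintype.card ι := by
    unfold kernel
    simp only [sgn_mul_self, prod_const]
    norm_num
  unfold noise
  rw [Fintype.expect_eq_sum_div_card, sum_eq_single x (fun y _ => hne y) (by simp), hx]
  simp

lemma expect_mul_noise (ρ : ℝ) (f g : (ι → Bool) → ℝ) :
    𝔼 x, f x * noise ρ g x = ∑ S : Finset ι, ρ ^ #S * (coeff f S * coeff g S) := by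
  simp_rw [noise_eq_sum, mul_sum, expect_sum_comm]
  refine sum_congr rfl fun S _ => ?_
  change _ = ρ ^ #S * ((𝔼 x, f x * chi S x) * coeff g S)
  rw [expect_mul, mul_expect]
  exact expect_congr rfl fun y _ => by ring

lemma expect_sq_eq_sum (f : (ι → Bool) → ℝ) : 𝔼 x, f x ^ 2 = ∑ S : Finset ι, coeff f S ^ 2 := by
  have := expect_mul_noise 1 f f
  simp only [noise_one, one_pow, one_mul, ← sq] at this
  exact this

lemma coeff_lap (i : ι) (f : (ι → Bool) → ℝ) (S : Finset ι) :
    coeff (lap i f) S = if i ∈ S then coeff f S else 0 := by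
  have h : 𝔼 x, f (flip i x) * chi S x = (if i ∈ S then -1 else 1) * coeff f S := by
    rw [← expect_flip i, coeff, mul_expect]
    refine expect_congr rfl fun x _ => ?_
    rw [flip_flip, chi_flip]
    ring
  have h2 : coeff (lap i f) S = (coeff f S - 𝔼 x, f (flip i x) * chi S x) / 2 := by
    rw [coeff, coeff, ← expect_sub_distrib, expect_div]
    exact expect_congr rfl fun x _ => by rw [lap]; ring
  rw [h2, h]
  split_ifs <;> ring

lemma lap_flip (i : ι) (f : (ι → Bool) → ℝ) (x : ι → Bool) : lap i f (flip i x) = -lap i f x := by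
  simp only [lap, flip_flip]
  ring

lemma noise_lap_flip (ρ : ℝ) (i : ι) (f : (ι → Bool) → ℝ) (x : ι → Bool) :
    noise ρ (lap i f) (flip i x) = -noise ρ (lap i f) x := by
  simp_rw [noise_eq_sum, coeff_lap, chi_flip, ← sum_neg_distrib]
  refine sum_congr rfl fun S _ => ?_
  split_ifs <;> ring

lemma sum_expect_lap_mul_noise (ρ : ℝ) (f : (ι → Bool) → ℝ) :
    ∑ i, 𝔼 x, lap i f x * noise ρ (lap i f) x =
      ∑ S : Finset ι, #S * ρ ^ #S * coeff f S ^ 2 := by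
  simp_rw [expect_mul_noise, coeff_lap]
  rw [sum_comm]
  refine sum_congr rfl fun S _ => ?_
  have : ∀ i, ρ ^ #S * ((if i ∈ S then coeff f S else 0) * (if i ∈ S then coeff f S else 0)) =
      if i ∈ S then ρ ^ #S * coeff f S ^ 2 else 0 := by
    intro i
    split_ifs <;> ring
  simp_rw [this, sum_ite_mem, univ_inter, sum_const, nsmul_eq_mul]
  ring

/-- The relative derivative of the noise kernel in direction `i`. -/
noncomputable def score (ρ : ℝ) (x : ι → Bool) (i : ι) (y : ι → Bool) : ℝ :=
  ρ * (sgn (x i) * sgn (y i)) / (1 + ρ * (sgn (x i) * sgn (y i)))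

lemma one_add_pos {ρ : ℝ} (h0 : 0 ≤ ρ) (h1 : ρ < 1) (a b : Bool) :
    0 < 1 + ρ * (sgn a * sgn b) := by
  rcases sgn_mul_sgn_eq a b with h | h <;> rw [h] <;> linarith

lemma kernel_pos {ρ : ℝ} (h0 : 0 ≤ ρ) (h1 : ρ < 1) (x y : ι → Bool) : 0 < kernel ρ x y :=
  prod_pos fun _ _ => one_add_pos h0 h1 _ _

lemma kernel_flip (ρ : ℝ) (x : ι → Bool) (i : ι) (y : ι → Bool) :
    kernel ρ x (flip i y) * (1 + ρ * (sgn (x i) * sgn (y i))) =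
      kernel ρ x y * (1 - ρ * (sgn (x i) * sgn (y i))) := by
  unfold kernel
  rw [← mul_prod_erase _ _ (mem_univ i),
    ← mul_prod_erase _ (fun j => 1 + ρ * (sgn (x j) * sgn (y j))) (mem_univ i),
    prod_congr rfl fun j hj => by rw [flip_of_ne (ne_of_mem_erase hj)]]
  simp only [flip_self, sgn_not]
  ring

lemma kernel_mul_score_flip {ρ : ℝ} (h0 : 0 ≤ ρ) (h1 : ρ < 1) (x : ι → Bool) (i : ι)
    (y : ι → Bool) :
    kernel ρ x (flip i y) * score ρ x i (flip i y) = -(kernel ρ x y * score ρ x i y) := by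
  have h := kernel_flip ρ x i y
  have p1 := one_add_pos h0 h1 (x i) (y i)
  have p2 := one_add_pos h0 h1 (x i) (!y i)
  simp only [score, flip_self]
  rw [mul_div_assoc', mul_div_assoc', ← neg_div, div_eq_div_iff p2.ne' p1.ne']
  simp only [sgn_not] at *
  linear_combination (-ρ * (sgn (x i) * sgn (y i))) * h

lemma score_flip_of_ne (ρ : ℝ) (x : ι → Bool) {i j : ι} (h : j ≠ i) (y : ι → Bool) :
    score ρ x j (flip i y) = score ρ x j y := by
  simp [score, flip_of_ne h]

lemma expect_kernel_mul_score {ρ : ℝ} (h0 : 0 ≤ ρ) (h1 : ρ < 1) (x : ι → Bool) (i : ι) :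
    𝔼 y, kernel ρ x y * score ρ x i y = 0 :=
  expect_eq_zero_of_flip i _ (kernel_mul_score_flip h0 h1 x i)

lemma expect_kernel_mul_score_mul_score {ρ : ℝ} (h0 : 0 ≤ ρ) (h1 : ρ < 1) (x : ι → Bool)
    (i j : ι) :
    𝔼 y, kernel ρ x y * (score ρ x i y * score ρ x j y) =
      if i = j then ρ ^ 2 / (1 - ρ ^ 2) else 0 := by
  split_ifs with h
  · subst h
    have hρ : 0 < 1 - ρ ^ 2 := by nlinarith
    have key : ∀ y, kernel ρ x y * (score ρ x i y * score ρ x i y) =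
        ρ ^ 2 / (1 - ρ ^ 2) * kernel ρ x y
          - 2 * ρ ^ 2 / (1 - ρ ^ 2) * (kernel ρ x y * score ρ x i y) := by
      intro y
      have p1 := one_add_pos h0 h1 (x i) (y i)
      have q1 : 0 < 1 - ρ := by linarith
      have q2 : 0 < 1 + ρ := by linarith
      unfold score
      rw [show 1 - ρ ^ 2 = (1 - ρ) * (1 + ρ) by ring]
      rcases sgn_mul_sgn_eq (x i) (y i) with h | h
      · rw [h, mul_one]
        field_simp
        ring
      · rw [h, mul_neg_one, ← sub_eq_add_neg]
        field_simp
        ring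
    simp_rw [key, expect_sub_distrib, ← mul_expect]
    rw [expect_kernel, expect_kernel_mul_score h0 h1]
    ring
  · refine expect_eq_zero_of_flip i _ fun y => ?_
    rw [← mul_assoc, kernel_mul_score_flip h0 h1, score_flip_of_ne ρ x (Ne.symm h)]
    ring

lemma noise_lap_eq {ρ : ℝ} (h0 : 0 ≤ ρ) (h1 : ρ < 1) (i : ι) (f : (ι → Bool) → ℝ)
    (x : ι → Bool) :
    noise ρ (lap i f) x = 𝔼 y, f y * (kernel ρ x y * score ρ x i y) := by
  have h : ∀ y, kernel ρ x y - kernel ρ x (flip i y) = 2 * (kernel ρ x y * score ρ x i y) := by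
    intro y
    have h := kernel_flip ρ x i y
    have p1 := one_add_pos h0 h1 (x i) (y i)
    unfold score
    generalize sgn (x i) * sgn (y i) = t at *
    field_simp
    linear_combination -h
  have h2 : 𝔼 y, f (flip i y) * kernel ρ x y = 𝔼 y, f y * kernel ρ x (flip i y) := by
    rw [← expect_flip i]
    simp
  have h3 : noise ρ (lap i f) x =
      (𝔼 y, f y * kernel ρ x y - 𝔼 y, f (flip i y) * kernel ρ x y) / 2 := by
    rw [noise, ← expect_sub_distrib, expect_div]
    exact expect_congr rfl fun y _ => by rw [lap]; ring
  rw [h3, h2, ← expect_sub_distrib, expect_div]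
  refine expect_congr rfl fun y _ => ?_
  linear_combination (f y / 2) * h y

/-- Pointwise gradient bound for the noise semigroup. -/
lemma sum_noise_lap_sq_le {ρ : ℝ} (h0 : 0 ≤ ρ) (h1 : ρ < 1) (f : (ι → Bool) → ℝ)
    (hf : ∀ x, f x ^ 2 ≤ 1) (x : ι → Bool) :
    ∑ i, noise ρ (lap i f) x ^ 2 ≤ ρ ^ 2 / (1 - ρ ^ 2) := by
  set a : ι → ℝ := fun i => noise ρ (lap i f) x with ha
  set A := ∑ i, a i ^ 2 with hA
  set B := ρ ^ 2 / (1 - ρ ^ 2) with hB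
  set g : (ι → Bool) → ℝ := fun y => ∑ i, a i * score ρ x i y with hg
  have hρ : 0 < 1 - ρ ^ 2 := by nlinarith
  have hAfg : A = 𝔼 y, kernel ρ x y * (f y * g y) := by
    simp_rw [hg, mul_sum, expect_sum_comm, hA]
    refine sum_congr rfl fun i _ => ?_
    rw [sq]
    nth_rw 2 [ha]
    simp only
    rw [noise_lap_eq h0 h1, mul_expect]
    exact expect_congr rfl fun y _ => by ring
  have hgg : 𝔼 y, kernel ρ x y * (g y * g y) = A * B := by
    have : ∀ y, kernel ρ x y * (g y * g y) =
        ∑ i, ∑ j, a i * a j * (kernel ρ x y * (score ρ x i y * score ρ x j y)) := by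
      intro y
      rw [hg, sum_mul_sum, mul_sum]
      refine sum_congr rfl fun i _ => ?_
      rw [mul_sum]
      exact sum_congr rfl fun j _ => by ring
    simp_rw [this, expect_sum_comm, ← mul_expect, expect_kernel_mul_score_mul_score h0 h1]
    simp [hA, sum_mul, sq, hB]
  have hff : 𝔼 y, kernel ρ x y * (f y * f y) ≤ 1 := by
    rw [← expect_kernel ρ x]
    refine expect_le_expect fun y _ => ?_
    have := hf y
    nlinarith [kernel_pos h0 h1 x y]
  have hpos : 0 ≤ 𝔼 y, kernel ρ x y * ((f y - g y) * (f y - g y)) :=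
    expect_nonneg fun y _ => mul_nonneg (kernel_pos h0 h1 x y).le (mul_self_nonneg _)
  have hA0 : 0 ≤ A := sum_nonneg fun i _ => sq_nonneg _
  have hB0 : 0 ≤ B := by positivity
  have cs := expect_mul_sq_le_sq_mul_sq univ (fun y => √(kernel ρ x y) * f y)
    (fun y => √(kernel ρ x y) * g y)
  have e1 : 𝔼 y, (√(kernel ρ x y) * f y) * (√(kernel ρ x y) * g y) = A := by
    rw [hAfg]
    refine expect_congr rfl fun y _ => ?_
    linear_combination (f y * g y) * Real.mul_self_sqrt (kernel_pos h0 h1 x y).le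
  have e2 : 𝔼 y, (√(kernel ρ x y) * f y) ^ 2 ≤ 1 := by
    refine le_trans (le_of_eq (expect_congr rfl fun y _ => ?_)) hff
    linear_combination (f y * f y) * Real.mul_self_sqrt (kernel_pos h0 h1 x y).le
  have e3 : 𝔼 y, (√(kernel ρ x y) * g y) ^ 2 = A * B := by
    rw [← hgg]
    refine expect_congr rfl fun y _ => ?_
    linear_combination (g y * g y) * Real.mul_self_sqrt (kernel_pos h0 h1 x y).le
  rw [e1, e3] at cs
  have : A * A ≤ A * B := by nlinarith [mul_nonneg hA0 hB0]
  rcases hA0.eq_or_lt with h | h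
  · rw [← h]; exact hB0
  · exact le_of_mul_le_mul_left this h

lemma chi_flip_of_notMem {S : Finset ι} {i : ι} (h : i ∉ S) (x : ι → Bool) :
    chi S (flip i x) = chi S x := by
  rw [chi_flip, if_neg h, one_mul]

/-- Bonami's lemma, with the degree bound distributed over the coefficients. -/
lemma expect_sum_chi_pow_four_le (A : Finset ι) (a : Finset ι → ℝ) :
    𝔼 x, (∑ S ∈ A.powerset, a S * chi S x) ^ 4 ≤ (∑ S ∈ A.powerset, 3 ^ #S * a S ^ 2) ^ 2 := by
  induction A using Finset.induction_on generalizing a with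
  | empty =>
    refine le_of_eq ?_
    simp only [powerset_empty, sum_singleton, chi, prod_empty, card_empty]
    rw [Fintype.expect_const]
    ring
  | insert i A hi ih =>
    set g₀ : (ι → Bool) → ℝ := fun x => ∑ S ∈ A.powerset, a S * chi S x with hg₀
    set g₁ : (ι → Bool) → ℝ := fun x => ∑ S ∈ A.powerset, a (insert i S) * chi S x with hg₁
    set B₀ := ∑ S ∈ A.powerset, 3 ^ #S * a S ^ 2 with hB₀
    set B₁ := ∑ S ∈ A.powerset, 3 ^ #S * a (insert i S) ^ 2 with hB₁
    have hmem : ∀ S ∈ A.powerset, i ∉ S := fun S hS h => hi (mem_powerset.1 hS h)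
    have hsum : ∀ x, ∑ S ∈ (insert i A).powerset, a S * chi S x = g₀ x + sgn (x i) * g₁ x := by
      intro x
      rw [sum_powerset_insert hi, hg₀, hg₁, mul_sum]
      congr 1
      refine sum_congr rfl fun S hS => ?_
      rw [chi, prod_insert (hmem S hS), ← chi]
      ring
    have hB : ∑ S ∈ (insert i A).powerset, 3 ^ #S * a S ^ 2 = B₀ + 3 * B₁ := by
      rw [sum_powerset_insert hi, hB₀, hB₁, mul_sum]
      congr 1
      refine sum_congr rfl fun S hS => ?_
      rw [card_insert_of_notMem (hmem S hS)]
      ring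
    have f₀ : ∀ x, g₀ (flip i x) = g₀ x := fun x =>
      sum_congr rfl fun S hS => by rw [chi_flip_of_notMem (hmem S hS)]
    have f₁ : ∀ x, g₁ (flip i x) = g₁ x := fun x =>
      sum_congr rfl fun S hS => by rw [chi_flip_of_notMem (hmem S hS)]
    have i₀ : 𝔼 x, g₀ x ^ 4 ≤ B₀ ^ 2 := ih a
    have i₁ : 𝔼 x, g₁ x ^ 4 ≤ B₁ ^ 2 := ih fun S => a (insert i S)
    have n₀ : 0 ≤ B₀ := sum_nonneg fun S _ => by positivity
    have n₁ : 0 ≤ B₁ := sum_nonneg fun S _ => by positivity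
    have cs := expect_mul_sq_le_sq_mul_sq univ (fun x => g₀ x ^ 2) (fun x => g₁ x ^ 2)
    simp only [← pow_mul] at cs
    norm_num at cs
    have i₂ : 𝔼 x, g₀ x ^ 2 * g₁ x ^ 2 ≤ B₀ * B₁ := by
      refine abs_le_of_sq_le_sq' ?_ (mul_nonneg n₀ n₁) |>.2
      refine cs.trans ?_
      rw [mul_pow]
      exact mul_le_mul i₀ i₁ (expect_nonneg fun x _ => by positivity) (sq_nonneg _)
    have odd : 𝔼 x, sgn (x i) * (4 * g₀ x ^ 3 * g₁ x + 4 * g₀ x * g₁ x ^ 3) = 0 := by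
      refine expect_eq_zero_of_flip i _ fun x => ?_
      rw [f₀, f₁, flip_self, sgn_not]
      ring
    have expand : ∀ x, (g₀ x + sgn (x i) * g₁ x) ^ 4 = g₀ x ^ 4 + 6 * (g₀ x ^ 2 * g₁ x ^ 2)
        + g₁ x ^ 4 + sgn (x i) * (4 * g₀ x ^ 3 * g₁ x + 4 * g₀ x * g₁ x ^ 3) := by
      intro x
      have h := sgn_mul_self (x i)
      generalize sgn (x i) = s at *
      have h2 : s ^ 2 = 1 := by rw [sq, h]
      have h3 : s ^ 3 = s := by rw [pow_succ, h2, one_mul]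
      have h4 : s ^ 4 = 1 := by rw [pow_succ, h3, h]
      linear_combination 6 * g₀ x ^ 2 * g₁ x ^ 2 * h2 + 4 * g₀ x * g₁ x ^ 3 * h3 + g₁ x ^ 4 * h4
    simp_rw [hsum, expand, expect_add_distrib, ← mul_expect]
    rw [odd, hB]
    nlinarith [mul_nonneg n₀ n₁]

/-- Level inequality: a function bounded by `1/2` and supported on a set of small measure has
little weight on low levels. -/
lemma low_weight_le (h : (ι → Bool) → ℝ) (δ : (ι → Bool) → ℝ) (p : ℝ) (hp : 𝔼 x, δ x = p)
    (hδ : ∀ x, δ x = 0 ∨ δ x = 1) (hh : ∀ x, h x ^ 2 = δ x / 4) (d : ℕ) :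
    ∑ S : Finset ι with #S ≤ d, coeff h S ^ 2 ≤ 3 ^ d * (p * √p) / 4 := by
  set W := ∑ S : Finset ι with #S ≤ d, coeff h S ^ 2 with hW
  set a : Finset ι → ℝ := fun S => if #S ≤ d then coeff h S else 0 with ha
  set g : (ι → Bool) → ℝ := fun x => ∑ S : Finset ι, a S * chi S x with hg
  have hp0 : 0 ≤ p := by
    rw [← hp]
    exact expect_nonneg fun x _ => by rcases hδ x with h | h <;> simp [h]
  have hW0 : 0 ≤ W := sum_nonneg fun S _ => sq_nonneg _
  have e1 : W = 𝔼 x, h x * g x := by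
    simp_rw [hg, mul_sum, expect_sum_comm, hW, sum_filter]
    refine sum_congr rfl fun S _ => ?_
    have : 𝔼 x, h x * (a S * chi S x) = a S * coeff h S := by
      rw [coeff, mul_expect]
      exact expect_congr rfl fun x _ => by ring
    rw [this, ha]
    simp only
    split_ifs <;> ring
  have e2 : 𝔼 x, g x ^ 4 ≤ (3 ^ d * W) ^ 2 := by
    have hb := expect_sum_chi_pow_four_le univ a
    rw [powerset_univ] at hb
    refine hb.trans ?_
    have h1 : ∑ S : Finset ι, 3 ^ #S * a S ^ 2 ≤ 3 ^ d * W := by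
      rw [hW, sum_filter, mul_sum]
      refine sum_le_sum fun S _ => ?_
      simp only [ha]
      split_ifs with hS
      · exact mul_le_mul_of_nonneg_right (pow_le_pow_right₀ (by norm_num) hS) (sq_nonneg _)
      · simp
    exact pow_le_pow_left₀ (sum_nonneg fun S _ => by positivity) h1 2
  have e3 : W ^ 2 ≤ (p / 4) * 𝔼 x, δ x * g x ^ 2 := by
    have cs := expect_mul_sq_le_sq_mul_sq univ h (fun x => δ x * g x)
    have c1 : 𝔼 x, h x * (δ x * g x) = W := by
      rw [e1]
      refine expect_congr rfl fun x _ => ?_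
      have := hh x
      rcases hδ x with h0 | h0 <;> rw [h0] at this ⊢
      · have : h x = 0 := by simpa using this
        simp [this]
      · ring
    have c2 : 𝔼 x, h x ^ 2 = p / 4 := by
      simp_rw [hh, ← expect_div, hp]
    have c3 : 𝔼 x, (δ x * g x) ^ 2 = 𝔼 x, δ x * g x ^ 2 :=
      expect_congr rfl fun x _ => by rcases hδ x with h0 | h0 <;> rw [h0] <;> ring
    rwa [c1, c2, c3] at cs
  have e4 : 𝔼 x, δ x * g x ^ 2 ≤ √p * (3 ^ d * W) := by
    have cs := expect_mul_sq_le_sq_mul_sq univ δ (fun x => g x ^ 2)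
    have c2 : 𝔼 x, δ x ^ 2 = p := by
      rw [← hp]
      exact expect_congr rfl fun x _ => by rcases hδ x with h0 | h0 <;> rw [h0] <;> norm_num
    rw [c2] at cs
    simp only [← pow_mul] at cs
    norm_num at cs
    refine abs_le_of_sq_le_sq' (cs.trans ?_) (by positivity) |>.2
    rw [mul_pow, Real.sq_sqrt hp0]
    exact mul_le_mul_of_nonneg_left e2 hp0
  have e5 : W * W ≤ W * (3 ^ d * (p * √p) / 4) := by
    have := mul_le_mul_of_nonneg_left e4 (show 0 ≤ p / 4 by positivity)
    nlinarith
  rcases hW0.eq_or_lt with h0 | h0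
  · rw [← h0]; positivity
  · exact le_of_mul_le_mul_left e5 h0

/-- The `0/1` real-valued indicator of a Boolean function. -/
def ind (f : (ι → Bool) → Bool) (x : ι → Bool) : ℝ := if f x then 1 else 0

/-- Positive sensitivity on the cube. -/
def posSens (f : (ι → Bool) → Bool) (x : ι → Bool) : ℕ :=
  if f x then 0 else #{i | f (flip i x) = true}

/-- The indicator that `f` is sensitive in direction `i`. -/
def sens (f : (ι → Bool) → Bool) (i : ι) (x : ι → Bool) : ℝ :=
  if f (flip i x) = f x then 0 else 1

lemma lap_ind_sq (f : (ι → Bool) → Bool) (i : ι) (x : ι → Bool) :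
    lap i (ind f) x ^ 2 = sens f i x / 4 := by
  unfold lap ind sens
  cases f x <;> cases f (flip i x) <;> norm_num

lemma sum_card_mul_le (f : (ι → Bool) → Bool) {ρ : ℝ} (h0 : 0 ≤ ρ) (h1 : ρ < 1) :
    ∑ S : Finset ι, #S * ρ ^ #S * coeff (ind f) S ^ 2 ≤
      √(ρ ^ 2 / (1 - ρ ^ 2)) * 𝔼 x, √(posSens f x) := by
  rw [← sum_expect_lap_mul_noise]
  have hi : ∀ i, 𝔼 x, lap i (ind f) x * noise ρ (lap i (ind f)) x =
      𝔼 x, 2 * ((1 - ind f x) * (lap i (ind f) x * noise ρ (lap i (ind f)) x)) := by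
    intro i
    set q : (ι → Bool) → ℝ := fun x => lap i (ind f) x * noise ρ (lap i (ind f)) x with hq
    have hqf : ∀ x, q (flip i x) = q x := fun x => by
      simp only [hq, lap_flip, noise_lap_flip]
      ring
    have h2 : 𝔼 x, ind f x * q x = 𝔼 x, (1 - ind f x) * q x := by
      rw [← expect_flip i]
      refine expect_congr rfl fun x _ => ?_
      rw [hqf]
      have : (ind f (flip i x) - (1 - ind f x)) * lap i (ind f) x = 0 := by
        unfold lap ind
        cases f x <;> cases f (flip i x) <;> norm_num
      simp only [hq]
      linear_combination noise ρ (lap i (ind f)) x * this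
    rw [← mul_expect, two_mul]
    nth_rw 1 [← h2]
    rw [← expect_add_distrib]
    exact expect_congr rfl fun x _ => by ring
  simp_rw [hi, ← expect_sum_comm, mul_expect]
  refine expect_le_expect fun x _ => ?_
  by_cases hf : f x = true
  · have : ind f x = 1 := by simp [ind, hf]
    simp only [this, sub_self, zero_mul, mul_zero, sum_const_zero]
    positivity
  · have hx : ind f x = 0 := by simp [ind, hf]
    simp only [hx, sub_zero, one_mul, ← mul_sum]
    have hs : ∑ i, lap i (ind f) x ^ 2 = posSens f x / 4 := by
      simp_rw [lap_ind_sq, ← sum_div]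
      congr 1
      have hf' : f x = false := by simpa using hf
      simp only [sens, posSens, hf', card_filter]
      push_cast
      refine sum_congr rfl fun i _ => ?_
      cases f (flip i x) <;> simp
    have cs := sum_mul_sq_le_sq_mul_sq univ (fun i => lap i (ind f) x)
      (fun i => noise ρ (lap i (ind f)) x)
    have hn := sum_noise_lap_sq_le h0 h1 (ind f) (fun y => by unfold ind; split_ifs <;> norm_num) x
    rw [hs] at cs
    have hρ : 0 < 1 - ρ ^ 2 := by nlinarith
    refine abs_le_of_sq_le_sq' ?_ (by positivity) |>.2
    rw [mul_pow, mul_pow, Real.sq_sqrt (by positivity), Real.sq_sqrt (by positivity)]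
    have := mul_le_mul_of_nonneg_left hn (show (0 : ℝ) ≤ posSens f x / 4 by positivity)
    nlinarith

lemma sum_one_sub_cos_pow_le (f : (ι → Bool) → Bool) {θ : ℝ} (h0 : 0 ≤ θ) (h1 : θ ≤ Real.pi / 2) :
    ∑ S : Finset ι, (1 - Real.cos θ ^ #S) * coeff (ind f) S ^ 2 ≤ 𝔼 x, √(posSens f x) * θ := by
  set Λ := 𝔼 x, √(posSens f x) with hΛ
  set φ : ℝ → ℝ := fun t => ∑ S : Finset ι, (1 - Real.cos t ^ #S) * coeff (ind f) S ^ 2 with hφ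
  set φ' : ℝ → ℝ := fun t => ∑ S : Finset ι,
    (#S * Real.cos t ^ (#S - 1) * Real.sin t) * coeff (ind f) S ^ 2 with hφ'
  have hd : ∀ t, HasDerivAt φ (φ' t) t := by
    intro t
    refine HasDerivAt.fun_sum fun S _ => ?_
    refine HasDerivAt.mul_const ?_ _
    have := ((Real.hasDerivAt_cos t).pow #S).const_sub 1
    exact this.congr_deriv (by ring)
  have key := (convex_Icc (0 : ℝ) θ).image_sub_le_mul_sub_of_deriv_le (f := φ) (C := Λ)
    (fun t _ => (hd t).continuousAt.continuousWithinAt)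
    (fun t _ => (hd t).differentiableAt.differentiableWithinAt) ?_ 0 (by simp [h0]) θ
    (by simp [h0]) h0
  · have z : φ 0 = 0 := by simp [hφ]
    rw [z, sub_zero, sub_zero] at key
    rw [← expect_mul]
    exact key
  · intro t ht
    rw [interior_Icc] at ht
    rw [(hd t).deriv]
    have hs : 0 < Real.sin t := Real.sin_pos_of_pos_of_lt_pi ht.1 (by linarith [ht.2, Real.pi_pos])
    have hc : 0 < Real.cos t := Real.cos_pos_of_mem_Ioo ⟨by linarith [ht.1, Real.pi_pos],
      by linarith [ht.2]⟩
    have hsc := Real.sin_sq_add_cos_sq t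
    have hc1 : Real.cos t < 1 := by nlinarith
    have := sum_card_mul_le f hc.le hc1
    have e : Real.cos t ^ 2 / (1 - Real.cos t ^ 2) = (Real.cos t / Real.sin t) ^ 2 := by
      rw [div_pow]
      congr 1
      linarith
    rw [e, Real.sqrt_sq (by positivity), ← hΛ] at this
    have e2 : Real.cos t / Real.sin t * φ' t =
        ∑ S : Finset ι, #S * Real.cos t ^ #S * coeff (ind f) S ^ 2 := by
      rw [hφ', mul_sum]
      refine sum_congr rfl fun S _ => ?_
      rcases Nat.eq_zero_or_pos #S with h | h
      · simp [h]
      · obtain ⟨k, hk⟩ := Nat.exists_eq_succ_of_ne_zero h.ne'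
        rw [hk]
        simp only [Nat.succ_eq_add_one, Nat.add_sub_cancel, pow_succ]
        field_simp
    rw [← e2] at this
    exact le_of_mul_le_mul_left this (by positivity)

/-- High levels carry little weight when the root of the positive sensitivity is small. -/
lemma high_weight_le (f : (ι → Bool) → Bool) {d : ℕ} (hd : 1 ≤ d) :
    ∑ S : Finset ι with ¬ #S ≤ d, coeff (ind f) S ^ 2 ≤ 4 * (𝔼 x, √(posSens f x)) / √d := by
  set Λ := 𝔼 x, √(posSens f x) with hΛ
  have hd' : (1 : ℝ) ≤ d := by exact_mod_cast hd
  have hsd : 1 ≤ √(d : ℝ) := by rw [Real.one_le_sqrt]; exact hd'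
  set θ := 1 / √(d : ℝ) with hθ
  have t0 : 0 < θ := by positivity
  have t1 : θ ≤ 1 := by rw [hθ, div_le_one (by positivity)]; exact hsd
  have tpi : θ ≤ Real.pi / 2 := by linarith [Real.pi_gt_three]
  have tsq : θ ^ 2 * d = 1 := by
    rw [hθ, div_pow, Real.sq_sqrt (by positivity)]
    field_simp
  have h := sum_one_sub_cos_pow_le f t0.le tpi
  have c0 : 0 ≤ Real.cos θ :=
    Real.cos_nonneg_of_mem_Icc ⟨by linarith [Real.pi_pos], tpi⟩
  have cd : (Real.cos θ ^ d) ^ 2 ≤ 1 / 2 := by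
    have b := Real.cos_le_one_div_sqrt_sq_add_one (x := θ) (by linarith [Real.pi_pos])
      (by linarith [Real.pi_gt_three])
    have b2 : Real.cos θ ^ 2 ≤ 1 / (θ ^ 2 + 1) := by
      have := pow_le_pow_left₀ c0 b 2
      rwa [div_pow, Real.sq_sqrt (by positivity), one_pow] at this
    have b3 : (2 : ℝ) ≤ (θ ^ 2 + 1) ^ d := by
      have := one_add_mul_le_pow (show (-2 : ℝ) ≤ θ ^ 2 by nlinarith [sq_nonneg θ]) d
      rw [add_comm (θ ^ 2)]
      linarith
    rw [← pow_mul, mul_comm d 2, pow_mul]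
    refine (pow_le_pow_left₀ (sq_nonneg _) b2 d).trans ?_
    rw [div_pow, one_pow]
    exact one_div_le_one_div_of_le (by norm_num) b3
  have cd' : Real.cos θ ^ d ≤ 3 / 4 := by
    refine abs_le_of_sq_le_sq' (cd.trans (by norm_num)) (by norm_num) |>.2
  have low : (1 / 4) * ∑ S : Finset ι with ¬ #S ≤ d, coeff (ind f) S ^ 2 ≤
      ∑ S : Finset ι, (1 - Real.cos θ ^ #S) * coeff (ind f) S ^ 2 := by
    rw [sum_filter, mul_sum]
    refine sum_le_sum fun S _ => ?_
    split_ifs with hS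
    · have : 0 ≤ 1 - Real.cos θ ^ #S := sub_nonneg.2 (pow_le_one₀ c0 (Real.cos_le_one _))
      rw [mul_zero]
      positivity
    · have : Real.cos θ ^ #S ≤ Real.cos θ ^ d :=
        pow_le_pow_of_le_one c0 (Real.cos_le_one _) (by omega)
      exact mul_le_mul_of_nonneg_right (by linarith) (sq_nonneg _)
  rw [← expect_mul, ← hΛ, hθ] at h
  have h' := low.trans h
  rw [mul_one_div] at h'
  rw [mul_div_assoc]
  linarith

/-- A one-sided Eldan–Gross type inequality for functions whose influences are all at most `p`. -/
theorem variance_le (f : (ι → Bool) → Bool) (p : ℝ) (hp : ∀ i, 𝔼 x, sens f i x = p) {d : ℕ}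
    (hd : 1 ≤ d) :
    (𝔼 x, ind f x) * (1 - 𝔼 x, ind f x) ≤
      Fintype.card ι * (3 ^ d * (p * √p) / 4) + 4 * (𝔼 x, √(posSens f x)) / √d := by
  have v : 𝔼 x, ind f x = ∑ S : Finset ι, coeff (ind f) S ^ 2 := by
    rw [← expect_sq_eq_sum]
    exact expect_congr rfl fun x _ => by unfold ind; split_ifs <;> norm_num
  have e : coeff (ind f) ∅ = 𝔼 x, ind f x := by simp [coeff, chi]
  have low : ∑ S : Finset ι with #S ≤ d, coeff (ind f) S ^ 2 ≤
      coeff (ind f) ∅ ^ 2 + Fintype.card ι * (3 ^ d * (p * √p) / 4) := by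
    have h1 : ∑ i, ∑ S : Finset ι with #S ≤ d, coeff (lap i (ind f)) S ^ 2 ≤
        Fintype.card ι * (3 ^ d * (p * √p) / 4) := by
      refine (sum_le_sum fun i _ => low_weight_le (lap i (ind f)) (sens f i) p (hp i)
        (fun x => by unfold sens; split_ifs <;> simp) (lap_ind_sq f i) d).trans ?_
      rw [sum_const, nsmul_eq_mul, card_univ]
    refine le_trans ?_ (add_le_add_right h1 _)
    rw [sum_comm, ← add_sum_erase (a := (∅ : Finset ι)) _ _ (by simp)]
    gcongr
    refine le_trans (sum_le_sum fun S hS => ?_)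
      (sum_le_sum_of_subset_of_nonneg (erase_subset ∅ _) fun S _ _ =>
        sum_nonneg fun i _ => sq_nonneg _)
    obtain ⟨i, hi⟩ := nonempty_iff_ne_empty.2 (ne_of_mem_erase hS)
    refine le_trans (le_of_eq ?_) (single_le_sum (fun i _ => sq_nonneg _) (mem_univ i))
    rw [coeff_lap, if_pos hi]
  have high := high_weight_le f hd
  have split := sum_filter_add_sum_filter_not (univ : Finset (Finset ι)) (fun S => #S ≤ d)
    (fun S => coeff (ind f) S ^ 2)
  rw [← v] at split
  rw [e] at low
  nlinarith

lemma expect_sens (f : (ι → Bool) → Bool) (i : ι) :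
    𝔼 x, sens f i x = 2 * 𝔼 x, if f x = false ∧ f (flip i x) = true then 1 else 0 := by
  have h : 𝔼 x, (if f x = false ∧ f (flip i x) = true then (1 : ℝ) else 0) =
      𝔼 x, if f (flip i x) = false ∧ f x = true then (1 : ℝ) else 0 := by
    rw [← expect_flip i]
    simp
  rw [two_mul]
  nth_rw 2 [h]
  rw [← expect_add_distrib]
  refine expect_congr rfl fun x _ => ?_
  unfold sens
  cases f x <;> cases f (flip i x) <;> norm_num

lemma sum_expect_sens (f : (ι → Bool) → Bool) :
    ∑ i, 𝔼 x, sens f i x = 2 * 𝔼 x, (posSens f x : ℝ) := by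
  simp_rw [expect_sens, ← mul_sum, ← expect_sum_comm]
  congr 1
  refine expect_congr rfl fun x _ => ?_
  unfold posSens
  cases hf : f x <;> simp

end Fourier

end BoolCube

namespace BoolCube

open Finset
open scoped BigOperators

section Graph

variable {n : ℕ}

/-- The edge slots of graphs on `Fin n`. -/
abbrev Slot (n : ℕ) : Type := {p : Sym2 (Fin n) // ¬ p.IsDiag}

/-- The graph whose edges are the slots with value `true`. -/
def toGraph (x : Slot n → Bool) : SimpleGraph (Fin n) :=
  SimpleGraph.fromEdgeSet {p | ∃ h, x ⟨p, h⟩ = true}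

lemma mem_edgeSet_toGraph (x : Slot n → Bool) (p : Sym2 (Fin n)) :
    p ∈ (toGraph x).edgeSet ↔ ∃ h, x ⟨p, h⟩ = true := by
  simp only [toGraph, SimpleGraph.edgeSet_fromEdgeSet, Set.mem_sdiff, Set.mem_ofPred_eq,
    Sym2.mem_diagSet, and_iff_left_iff_imp]
  exact fun ⟨h, _⟩ => h

open Classical in
/-- Graphs on `Fin n` are the points of the cube indexed by the edge slots. -/
noncomputable def graphEquiv (n : ℕ) : (Slot n → Bool) ≃ SimpleGraph (Fin n) where
  toFun := toGraph
  invFun G p := decide (p.1 ∈ G.edgeSet)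
  left_inv x := by
    ext p
    simp only [mem_edgeSet_toGraph]
    simp [p.2]
  right_inv G := by
    rw [← SimpleGraph.edgeSet_inj]
    ext p
    simp only [mem_edgeSet_toGraph, decide_eq_true_eq, exists_prop, and_iff_right_iff_imp]
    exact fun h => G.not_isDiag_of_mem_edgeSet h

lemma card_slot (n : ℕ) : Fintype.card (Slot n) = n.choose 2 := by
  rw [Sym2.card_subtype_not_diag, Fintype.card_fin]

open Classical in
lemma graphProb_eq (P : SimpleGraph (Fin n) → Prop) :
    graphProb n P = 𝔼 x : Slot n → Bool, if P (toGraph x) then 1 else 0 := by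
  have h : Nat.card {G : SimpleGraph (Fin n) // P G} = #{x : Slot n → Bool | P (toGraph x)} := by
    rw [← Fintype.card_subtype, ← Nat.card_eq_fintype_card]
    exact Nat.card_congr ((graphEquiv n).subtypeEquiv fun _ => Iff.rfl).symm
  rw [graphProb, h, Fintype.expect_eq_sum_div_card, sum_boole, Fintype.card_fun, Fintype.card_bool,
    card_slot]
  push_cast
  rfl

/-- The Boolean function on the cube attached to a Boolean function of graphs. -/
def onCube (f : SimpleGraph (Fin n) → Bool) (x : Slot n → Bool) : Bool := f (toGraph x)

lemma toGraph_flip (p : Slot n) (x : Slot n → Bool) :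
    toGraph (flip p x) = SimpleGraph.fromEdgeSet (symmDiff (toGraph x).edgeSet {p.1}) := by
  rw [← SimpleGraph.edgeSet_inj]
  ext q
  rw [mem_edgeSet_toGraph, SimpleGraph.edgeSet_fromEdgeSet, Set.mem_sdiff, Set.mem_symmDiff,
    mem_edgeSet_toGraph, Set.mem_singleton_iff, Sym2.mem_diagSet]
  by_cases hq : q.IsDiag
  · simp [hq]
  · by_cases hpq : q = p.1
    · subst hpq
      simp [p.2]
    · have : (⟨q, hq⟩ : Slot n) ≠ p := fun h => hpq (by rw [← h])
      simp [hq, hpq, flip_of_ne this]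

lemma gPosSens_toGraph (f : SimpleGraph (Fin n) → Bool) (x : Slot n → Bool) :
    gPosSens f (toGraph x) = posSens (onCube f) x := by
  unfold gPosSens posSens
  change (if onCube f x = true then 0 else _) = _
  split_ifs with h
  · rfl
  · rw [← Fintype.card_subtype, ← Nat.card_eq_fintype_card]
    refine Nat.card_congr ((Equiv.subtypeSubtypeEquivSubtypeInter _ _).symm.trans
      (Equiv.subtypeEquivRight fun p => ?_))
    rw [onCube, toGraph_flip]

/-- The action of a vertex permutation on edge slots. -/
def slotPerm (σ : Equiv.Perm (Fin n)) : Equiv.Perm (Slot n) where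
  toFun p := ⟨p.1.map σ, by rw [Sym2.isDiag_map σ.injective]; exact p.2⟩
  invFun p := ⟨p.1.map σ.symm, by rw [Sym2.isDiag_map σ.symm.injective]; exact p.2⟩
  left_inv p := by ext1; simp [Sym2.map_map]
  right_inv p := by ext1; simp [Sym2.map_map]

lemma toGraph_comp_slotPerm (σ : Equiv.Perm (Fin n)) (x : Slot n → Bool) :
    toGraph (x ∘ slotPerm σ) = (toGraph x).map σ.symm.toEmbedding := by
  rw [SimpleGraph.map_symm]
  ext a b
  rw [SimpleGraph.comap_adj, ← SimpleGraph.mem_edgeSet, ← SimpleGraph.mem_edgeSet,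
    mem_edgeSet_toGraph, mem_edgeSet_toGraph]
  constructor
  · rintro ⟨h, hx⟩
    exact ⟨_, hx⟩
  · rintro ⟨h, hx⟩
    refine ⟨fun h' => h ?_, hx⟩
    rw [Sym2.mk_isDiag_iff] at h' ⊢
    rw [h']

lemma flip_comp (τ : Equiv.Perm (Slot n)) (i : Slot n) (x : Slot n → Bool) :
    flip i (x ∘ τ) = flip (τ i) x ∘ τ := by
  ext j
  by_cases h : j = i
  · subst h; simp
  · rw [flip_of_ne h, Function.comp_apply, Function.comp_apply, flip_of_ne (τ.injective.ne h)]

lemma exists_slotPerm_eq (p q : Slot n) : ∃ σ, slotPerm σ p = q := by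
  obtain ⟨p, hp⟩ := p
  obtain ⟨q, hq⟩ := q
  induction p using Sym2.ind with | _ a b => ?_
  induction q using Sym2.ind with | _ c d => ?_
  rw [Sym2.mk_isDiag_iff] at hp hq
  refine ⟨(Equiv.swap a c).trans (Equiv.swap (Equiv.swap a c b) d), Subtype.ext ?_⟩
  have h : Equiv.swap a c b ≠ c := fun h =>
    hp ((Equiv.swap a c).injective (by rw [h, Equiv.swap_apply_left]))
  simp [slotPerm, Equiv.swap_apply_of_ne_of_ne (Ne.symm h) hq]

lemma expect_sens_eq (f : SimpleGraph (Fin n) → Bool)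
    (hf : ∀ (σ : Equiv.Perm (Fin n)) G, f (G.map σ.toEmbedding) = f G) (i j : Slot n) :
    𝔼 x, sens (onCube f) i x = 𝔼 x, sens (onCube f) j x := by
  obtain ⟨σ, rfl⟩ := exists_slotPerm_eq i j
  have inv : ∀ x, onCube f (x ∘ slotPerm σ) = onCube f x := fun x => by
    rw [onCube, toGraph_comp_slotPerm, hf, onCube]
  refine (Fintype.expect_equiv (Equiv.arrowCongr (slotPerm σ).symm (Equiv.refl Bool)) _ _
    fun x => ?_).symm
  change _ = sens (onCube f) i (x ∘ slotPerm σ)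
  rw [sens, sens, flip_comp, inv, inv]

lemma graph_variance_le (f : SimpleGraph (Fin n) → Bool)
    (hf : ∀ (σ : Equiv.Perm (Fin n)) G, f (G.map σ.toEmbedding) = f G) (hn : 2 ≤ n)
    {d : ℕ} (hd : 1 ≤ d) {p : ℝ}
    (hp : p = 2 * (𝔼 x, (posSens (onCube f) x : ℝ)) / (n.choose 2 : ℕ)) :
    graphProb n (fun G => f G = true) * (1 - graphProb n (fun G => f G = true)) ≤
      (n.choose 2 : ℕ) * (3 ^ d * (p * √p) / 4) + 4 * (𝔼 x, √(posSens (onCube f) x)) / √d := by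
  have h1 : graphProb n (fun G => f G = true) = 𝔼 x, ind (onCube f) x := by
    rw [graphProb_eq]
    refine expect_congr rfl fun x _ => ?_
    unfold ind onCube
    congr
  rw [h1, ← card_slot]
  refine variance_le (onCube f) p (fun i => ?_) hd
  have hs := sum_expect_sens (onCube f)
  rw [sum_congr rfl fun j _ => expect_sens_eq f hf j i, sum_const, card_univ, card_slot,
    nsmul_eq_mul] at hs
  have hc : (0 : ℝ) < (n.choose 2 : ℕ) := by exact_mod_cast Nat.choose_pos hn
  rw [hp, ← hs]
  field_simp

end Graph

end BoolCube

namespace BoolCube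

open Finset
open scoped BigOperators

section Layers

variable {Ω : Type*} [Fintype Ω]

open Classical in
/-- The probability that `s` is positive. -/
noncomputable def probPos (s : Ω → ℕ) : ℝ := 𝔼 x, if 0 < s x then 1 else 0

open Classical in
/-- The probability that `s` lies in the `j`-th dyadic layer. -/
noncomputable def layer (s : Ω → ℕ) (j : ℤ) : ℝ :=
  𝔼 x, if (s x : ℝ) ∈ Set.Icc ((2 : ℝ) ^ j) ((2 : ℝ) ^ (j + 1)) then 1 else 0

lemma layer_nonneg (s : Ω → ℕ) (j : ℤ) : 0 ≤ layer s j :=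
  expect_nonneg fun _ _ => by split_ifs <;> norm_num

lemma expect_le_layers (s : Ω → ℕ) {M : ℕ} (hs : ∀ x, s x ≤ M) (h : ℝ → ℝ)
    (hmono : ∀ u v, 0 ≤ u → u ≤ v → h u ≤ h v) (h0 : h 0 = 0) (a : ℤ) :
    𝔼 x, h (s x) ≤ h (2 ^ a) * probPos s +
      ∑ j ∈ Icc a ⌊Real.logb 2 M⌋, h (2 ^ (j + 1)) * layer s j := by
  classical
  have hnn : ∀ k : ℤ, 0 ≤ h (2 ^ k) := fun k => by
    rw [← h0]; exact hmono _ _ le_rfl (by positivity)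
  unfold probPos layer
  simp_rw [mul_expect, ← expect_sum_comm, ← expect_add_distrib]
  refine expect_le_expect fun x _ => ?_
  have hsum : 0 ≤ ∑ j ∈ Icc a ⌊Real.logb 2 M⌋, h (2 ^ (j + 1)) *
      (if (s x : ℝ) ∈ Set.Icc ((2 : ℝ) ^ j) ((2 : ℝ) ^ (j + 1)) then 1 else 0) :=
    sum_nonneg fun j _ => mul_nonneg (hnn _) (by split_ifs <;> norm_num)
  rcases Nat.eq_zero_or_pos (s x) with hx | hx
  · have hz : h (s x) = 0 := by rw [hx, Nat.cast_zero, h0]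
    rw [hz, if_neg hx.le.not_gt, mul_zero, zero_add]
    exact hsum
  · have hx' : (0 : ℝ) < s x := by exact_mod_cast hx
    have l1 : (2 : ℝ) ^ Int.log 2 (s x : ℝ) ≤ s x := by
      exact_mod_cast Int.zpow_log_le_self (b := 2) one_lt_two hx'
    have l2 : (s x : ℝ) < 2 ^ (Int.log 2 (s x : ℝ) + 1) := by
      exact_mod_cast Int.lt_zpow_succ_log_self (b := 2) one_lt_two (s x : ℝ)
    rw [if_pos hx, mul_one]
    by_cases hj : Int.log 2 (s x : ℝ) < a
    · have : (2 : ℝ) ^ (Int.log 2 (s x : ℝ) + 1) ≤ 2 ^ a :=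
        zpow_le_zpow_right₀ one_le_two (by omega)
      have := hmono (s x) (2 ^ a) hx'.le (l2.le.trans this)
      linarith
    · have hb : Int.log 2 (s x : ℝ) ≤ ⌊Real.logb 2 M⌋ := by
        have hf := Real.floor_logb_natCast (b := 2) (r := (s x : ℝ)) hx'.le
        rw [← hf]
        exact Int.floor_le_floor
          (Real.logb_le_logb_of_le one_lt_two hx' (by exact_mod_cast hs x))
      have hmem : Int.log 2 (s x : ℝ) ∈ Icc a ⌊Real.logb 2 M⌋ := mem_Icc.2 ⟨by omega, hb⟩
      have := single_le_sum (f := fun j => h (2 ^ (j + 1)) *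
        (if (s x : ℝ) ∈ Set.Icc ((2 : ℝ) ^ j) ((2 : ℝ) ^ (j + 1)) then 1 else 0))
        (fun j _ => mul_nonneg (hnn _) (by split_ifs <;> norm_num)) hmem
      simp only [Set.mem_Icc, l1, l2.le, and_self, if_true, mul_one] at this
      have h3 := hmono (s x) _ hx'.le l2.le
      have := hnn a
      simp only [Set.mem_Icc]
      linarith

end Layers

section IteratedLog

lemma exists_iterLog_mem {x : ℝ} (hx : 1 ≤ x) : ∃ k, iterLog k x ∈ Set.Ico 1 (Real.exp 1) := by
  by_contra! hne
  have h : ∀ k : ℕ, 1 ≤ iterLog k x ∧ iterLog k x ≤ x - k := by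
    intro k
    induction k with
    | zero => simp [iterLog, hx]
    | succ k ih =>
      have he : Real.exp 1 ≤ iterLog k x := not_lt.1 fun hlt => hne k ⟨ih.1, hlt⟩
      have hpos : 0 < iterLog k x := by linarith
      refine ⟨(Real.le_log_iff_exp_le hpos).2 he, ?_⟩
      have := Real.log_le_sub_one_of_pos hpos
      rw [iterLog]
      push_cast
      linarith [ih.2]
  obtain ⟨k, hk⟩ := exists_nat_gt x
  linarith [(h k).1, (h k).2]

lemma iterLog_logStar_mem {x : ℝ} (hx : 1 ≤ x) :
    iterLog (logStar x) x ∈ Set.Ico 1 (Real.exp 1) :=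
  Nat.sInf_mem (s := {k : ℕ | iterLog k x ∈ Set.Ico 1 (Real.exp 1)}) (exists_iterLog_mem hx)

lemma exp_one_le_iterLog {x : ℝ} (hx : 1 ≤ x) {k : ℕ} (hk : k < logStar x) :
    Real.exp 1 ≤ iterLog k x := by
  induction k with
  | zero =>
    by_contra! h
    exact Nat.notMem_of_lt_sInf hk ⟨hx, h⟩
  | succ k ih =>
    have he := ih (by omega)
    have h1 : 1 ≤ iterLog (k + 1) x :=
      (Real.le_log_iff_exp_le (by linarith [Real.exp_pos 1])).2 he
    by_contra! h
    exact Nat.notMem_of_lt_sInf hk ⟨h1, h⟩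

lemma two_mul_iterLog_succ_le {x : ℝ} {k : ℕ} (h : 0 < iterLog k x) :
    2 * iterLog (k + 1) x ≤ iterLog k x := by
  have h1 : iterLog k x = Real.exp (iterLog (k + 1) x) := (Real.exp_log h).symm
  have h2 := Real.add_one_le_exp (iterLog (k + 1) x - 1)
  have h3 : Real.exp (iterLog (k + 1) x) = Real.exp (iterLog (k + 1) x - 1) * Real.exp 1 := by
    rw [← Real.exp_add]
    ring_nf
  have h4 := Real.exp_pos (iterLog (k + 1) x - 1)
  have h5 := Real.add_one_le_exp 1
  rw [h1, h3]
  nlinarith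

end IteratedLog

section Bounds

variable {Ω : Type*} [Fintype Ω]

lemma logb_two_le {x : ℝ} (hx : 1 ≤ x) : Real.logb 2 x ≤ 3 / 2 * Real.log x := by
  rw [Real.logb, div_le_iff₀ (Real.log_pos one_lt_two)]
  nlinarith [Real.log_two_gt_d9, Real.log_nonneg hx]

lemma logb_choose_two_nonneg {n : ℕ} (hn : 2 ≤ n) : 0 ≤ Real.logb 2 (n.choose 2 : ℕ) :=
  Real.logb_nonneg one_lt_two (by exact_mod_cast Nat.choose_pos hn)

lemma logb_choose_two_le {n : ℕ} (hn : 2 ≤ n) :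
    Real.logb 2 (n.choose 2 : ℕ) ≤ 3 * Real.log n := by
  have hn' : (1 : ℝ) ≤ n := by exact_mod_cast (by omega : 1 ≤ n)
  have hc : (0 : ℝ) < (n.choose 2 : ℕ) := by exact_mod_cast Nat.choose_pos hn
  have h1 : ((n.choose 2 : ℕ) : ℝ) ≤ (n : ℝ) ^ 2 := by exact_mod_cast Nat.choose_le_pow n 2
  have h2 := Real.logb_le_logb_of_le one_lt_two hc h1
  have h3 : Real.logb 2 ((n : ℝ) ^ 2) = 2 * Real.logb 2 n := by
    rw [Real.logb_pow]; norm_num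
  linarith [logb_two_le hn']

lemma card_Icc_le {n : ℕ} (hn : 2 ≤ n) (hlog : 1 ≤ Real.log n) {a : ℤ} (ha : 0 ≤ a) :
    (#(Icc a ⌊Real.logb 2 (n.choose 2 : ℕ)⌋) : ℝ) ≤ 4 * Real.log n := by
  have h1 := logb_choose_two_le hn
  have h2 := Int.floor_le (Real.logb 2 (n.choose 2 : ℕ))
  have h0 : 0 ≤ ⌊Real.logb 2 (n.choose 2 : ℕ)⌋ := Int.floor_nonneg.2 (logb_choose_two_nonneg hn)
  rw [Int.card_Icc]
  have h3 : ((⌊Real.logb 2 (n.choose 2 : ℕ)⌋ + 1 - a).toNat : ℤ) ≤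
      ⌊Real.logb 2 (n.choose 2 : ℕ)⌋ + 1 := by omega
  have h4 : ((⌊Real.logb 2 (n.choose 2 : ℕ)⌋ + 1 - a).toNat : ℝ) ≤
      ⌊Real.logb 2 (n.choose 2 : ℕ)⌋ + 1 := by exact_mod_cast h3
  linarith

lemma sqrt_le_self_of_one_le {x : ℝ} (hx : 1 ≤ x) : √x ≤ x :=
  Real.sqrt_le_iff.2 ⟨by linarith, by nlinarith⟩

lemma zpow_floor_le_rpow (t : ℝ) : (2 : ℝ) ^ ⌊t⌋ ≤ 2 ^ t := by
  rw [← Real.rpow_intCast]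
  exact Real.rpow_le_rpow_of_exponent_le one_le_two (Int.floor_le t)

lemma two_rpow_logb {x : ℝ} (hx : 0 < x) : (2 : ℝ) ^ Real.logb 2 x = x :=
  Real.rpow_logb two_pos (by norm_num) hx

lemma sqrt_two_zpow (j : ℤ) : √((2 : ℝ) ^ j) = 2 ^ ((j : ℝ) / 2) := by
  rw [Real.sqrt_eq_rpow, ← Real.rpow_intCast, ← Real.rpow_mul zero_le_two]
  ring_nf

/-- Mean sensitivity bound when the sensitive set and the upper layers are small. -/
lemma expect_le_of_layers (s : Ω → ℕ) {n : ℕ} (hn : 2 ≤ n) (hlog : 1 ≤ Real.log n)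
    (hs : ∀ x, s x ≤ n.choose 2) {κ : ℝ} (hκ : 0 ≤ κ)
    (h1 : probPos s ≤ κ * √(Real.log n / n))
    (h2 : ∀ j : ℤ, ⌊Real.logb 2 n / 2⌋ ≤ j → j ≤ ⌊Real.logb 2 (n.choose 2 : ℕ)⌋ →
      2 ^ j * layer s j ≤ κ * √n * Real.log n ^ 5) :
    𝔼 x, (s x : ℝ) ≤ 9 * κ * √n * Real.log n ^ 6 := by
  have hn0 : (0 : ℝ) < n := by exact_mod_cast (by omega : 0 < n)
  have hn1 : (1 : ℝ) ≤ n := by exact_mod_cast (by omega : 1 ≤ n)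
  have hlay := expect_le_layers s hs id (fun _ _ _ h => h) rfl ⌊Real.logb 2 n / 2⌋
  simp only [id] at hlay
  have ha : 0 ≤ ⌊Real.logb 2 n / 2⌋ :=
    Int.floor_nonneg.2 (by have := Real.logb_nonneg one_lt_two hn1; positivity)
  have head : (2 : ℝ) ^ ⌊Real.logb 2 n / 2⌋ ≤ √n := by
    refine (zpow_floor_le_rpow _).trans (le_of_eq ?_)
    rw [div_eq_mul_inv, Real.rpow_mul zero_le_two, two_rpow_logb hn0, Real.sqrt_eq_rpow, one_div]
  have hp0 : 0 ≤ probPos s := expect_nonneg fun _ _ => by split_ifs <;> norm_num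
  have head' : (2 : ℝ) ^ ⌊Real.logb 2 n / 2⌋ * probPos s ≤ κ * √n * Real.log n ^ 6 := by
    refine (mul_le_mul head h1 hp0 (Real.sqrt_nonneg _)).trans ?_
    have hsq : √n * √(Real.log n / n) = √(Real.log n) := by
      rw [← Real.sqrt_mul hn0.le]
      congr 1
      field_simp
    have hsl : √(Real.log n) ≤ Real.log n ^ 6 := by
      refine (sqrt_le_self_of_one_le hlog).trans ?_
      exact le_self_pow₀ hlog (by norm_num)
    have hsn : 1 ≤ √(n : ℝ) := Real.one_le_sqrt.2 hn1
    calc √n * (κ * √(Real.log n / n)) = κ * √(Real.log n) := by rw [← hsq]; ring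
      _ ≤ κ * (√n * Real.log n ^ 6) := by
        refine mul_le_mul_of_nonneg_left (hsl.trans ?_) hκ
        exact le_mul_of_one_le_left (by positivity) hsn
      _ = _ := by ring
  have tail : ∑ j ∈ Icc ⌊Real.logb 2 n / 2⌋ ⌊Real.logb 2 (n.choose 2 : ℕ)⌋,
      (2 : ℝ) ^ (j + 1) * layer s j ≤ 4 * Real.log n * (2 * (κ * √n * Real.log n ^ 5)) := by
    refine (sum_le_card_nsmul _ _ (2 * (κ * √n * Real.log n ^ 5)) fun j hj => ?_).trans ?_
    · rw [mem_Icc] at hj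
      rw [zpow_add_one₀ two_ne_zero]
      linarith [h2 j hj.1 hj.2]
    · rw [nsmul_eq_mul]
      exact mul_le_mul_of_nonneg_right (card_Icc_le hn hlog ha) (by positivity)
  calc _ ≤ _ := hlay
    _ ≤ _ := add_le_add head' tail
    _ = _ := by ring

/-- Root sensitivity bound when the sensitive set, the middle layers and the upper layers are
small. -/
lemma expect_sqrt_le_of_layers (s : Ω → ℕ) {n : ℕ} (hn : 2 ≤ n) (hlog : 1 ≤ Real.log n)
    (hstar : 2 ≤ logStar n)
    (hs : ∀ x, s x ≤ n.choose 2) {κ : ℝ} (hκ : 0 ≤ κ)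
    (h1 : probPos s ≤ κ * √(Real.log n / n))
    (h2 : ∀ j : ℤ, ⌊Real.logb 2 n / 2⌋ ≤ j → j ≤ ⌊Real.logb 2 (n.choose 2 : ℕ)⌋ →
      2 ^ j * layer s j ≤ κ * √n * Real.log n ^ 5)
    (h3 : ∀ ℓ : ℕ, 2 ≤ ℓ → ℓ + 1 ≤ logStar n → ∀ j : ℤ,
      ⌊Real.logb 2 n + 30 * iterLog (ℓ + 1) n⌋ ≤ j → j ≤ ⌊Real.logb 2 n + 30 * iterLog ℓ n⌋ →
      (2 : ℝ) ^ ((j : ℝ) / 2) * layer s j ≤ κ * √(Real.log n) / iterLog ℓ n ^ 2) :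
    𝔼 x, √(s x : ℝ) ≤ 2 ^ 46 * κ * √(Real.log n) := by
  have hn0 : (0 : ℝ) < n := by exact_mod_cast (by omega : 0 < n)
  have hn1 : (1 : ℝ) ≤ n := by exact_mod_cast (by omega : 1 ≤ n)
  set L := logStar n with hL
  set y : ℕ → ℝ := fun k => iterLog k n with hy
  set a : ℕ → ℤ := fun k => ⌊Real.logb 2 n + 30 * y k⌋ with ha
  set b := ⌊Real.logb 2 (n.choose 2 : ℕ)⌋ with hb
  have hlb : 0 ≤ Real.logb 2 n := Real.logb_nonneg one_lt_two hn1
  have hyL := iterLog_logStar_mem hn1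
  have hy1 : ∀ k ≤ L, 1 ≤ y k := fun k hk => by
    rcases hk.eq_or_lt with rfl | hk
    · exact hyL.1
    · exact (by linarith [Real.add_one_le_exp 1] : (1 : ℝ) ≤ Real.exp 1).trans
        (exp_one_le_iterLog hn1 hk)
  have hsl : 1 ≤ √(Real.log n) := Real.one_le_sqrt.2 hlog
  have hs2 : √2 ≤ 2 := sqrt_le_self_of_one_le one_le_two
  have hs20 : 0 ≤ √(2 : ℝ) := Real.sqrt_nonneg _
  have hterm : ∀ j : ℤ, √((2 : ℝ) ^ (j + 1)) * layer s j ≤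
      2 * ((2 : ℝ) ^ ((j : ℝ) / 2) * layer s j) := by
    intro j
    have : √((2 : ℝ) ^ (j + 1)) ≤ 2 * (2 : ℝ) ^ ((j : ℝ) / 2) := by
      rw [zpow_add_one₀ two_ne_zero, Real.sqrt_mul (by positivity), sqrt_two_zpow, mul_comm]
      exact mul_le_mul_of_nonneg_right hs2 (by positivity)
    rw [← mul_assoc]
    exact mul_le_mul_of_nonneg_right this (layer_nonneg s j)
  have hterm0 : ∀ j : ℤ, 0 ≤ √((2 : ℝ) ^ (j + 1)) * layer s j := fun j =>
    mul_nonneg (Real.sqrt_nonneg _) (layer_nonneg s j)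
  have hlay := expect_le_layers s hs Real.sqrt (fun _ _ _ h => Real.sqrt_le_sqrt h) Real.sqrt_zero
    (a L)
  have hp0 : 0 ≤ probPos s := expect_nonneg fun _ _ => by split_ifs <;> norm_num
  have head : √((2 : ℝ) ^ a L) * probPos s ≤ 2 ^ 45 * (κ * √(Real.log n)) := by
    have e1 : (2 : ℝ) ^ a L ≤ n * 2 ^ 90 := by
      refine (zpow_floor_le_rpow _).trans ?_
      rw [Real.rpow_add two_pos, two_rpow_logb hn0]
      refine mul_le_mul_of_nonneg_left ?_ hn0.le
      rw [← Real.rpow_natCast 2 90]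
      refine Real.rpow_le_rpow_of_exponent_le one_le_two ?_
      have : y L < Real.exp 1 := hyL.2
      push_cast
      linarith [Real.exp_one_lt_d9]
    have e2 : √((2 : ℝ) ^ a L) ≤ √n * 2 ^ 45 := by
      refine (Real.sqrt_le_sqrt e1).trans (le_of_eq ?_)
      rw [Real.sqrt_mul hn0.le, show (2 : ℝ) ^ 90 = (2 ^ 45) ^ 2 by norm_num,
        Real.sqrt_sq (by positivity)]
    refine (mul_le_mul e2 h1 hp0 (by positivity)).trans (le_of_eq ?_)
    have hsq : √n * √(Real.log n / n) = √(Real.log n) := by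
      rw [← Real.sqrt_mul hn0.le]
      congr 1
      field_simp
    rw [← hsq]
    ring
  have upper : ∑ j ∈ Icc (a 2) b, √((2 : ℝ) ^ (j + 1)) * layer s j ≤
      16 * (κ * √(Real.log n)) := by
    have hy2 : 1 ≤ y 2 := hy1 2 hstar
    have ha0 : 0 ≤ a 2 := Int.floor_nonneg.2 (by positivity)
    have hlarge : √n * Real.log n ^ 5 ≤ 2 * (2 : ℝ) ^ (((a 2 : ℤ) : ℝ) / 2) / Real.log n ^ 5 := by
      have f1 := Int.lt_floor_add_one (Real.logb 2 n + 30 * y 2)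
      have f2 : (Real.logb 2 n + 30 * y 2) / 2 ≤ 1 + ((a 2 : ℤ) : ℝ) / 2 := by
        simp only [ha]
        linarith
      have f3 := Real.rpow_le_rpow_of_exponent_le one_le_two f2
      rw [Real.rpow_add two_pos, Real.rpow_one, add_div, Real.rpow_add two_pos,
        div_eq_mul_inv (Real.logb 2 n), Real.rpow_mul zero_le_two, two_rpow_logb hn0, ← one_div,
        ← Real.sqrt_eq_rpow] at f3
      have f4 : Real.log n ^ 10 ≤ (2 : ℝ) ^ (30 * y 2 / 2) := by
        have g1 : Real.log n = Real.exp (y 2) :=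
          (Real.exp_log (by linarith : 0 < Real.log n)).symm
        rw [g1, ← Real.exp_nat_mul, Real.rpow_def_of_pos two_pos]
        refine Real.exp_le_exp.2 ?_
        push_cast
        nlinarith [Real.log_two_gt_d9]
      rw [le_div_iff₀ (by positivity)]
      refine le_trans (le_trans (le_of_eq (by ring)) (mul_le_mul_of_nonneg_left f4
        (Real.sqrt_nonneg n))) f3
    refine (sum_le_card_nsmul _ _ (4 * κ / Real.log n ^ 5) fun j hj => ?_).trans ?_
    · rw [mem_Icc] at hj
      refine (hterm j).trans ?_
      have hja : ⌊Real.logb 2 n / 2⌋ ≤ j := by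
        refine le_trans (Int.floor_le_floor ?_) hj.1
        linarith
      have hj2 := h2 j hja hj.2
      have hsplit : (2 : ℝ) ^ j = 2 ^ ((j : ℝ) / 2) * 2 ^ ((j : ℝ) / 2) := by
        rw [← Real.rpow_add two_pos, add_halves, Real.rpow_intCast]
      have hmono : (2 : ℝ) ^ (((a 2 : ℤ) : ℝ) / 2) ≤ 2 ^ ((j : ℝ) / 2) := by
        refine Real.rpow_le_rpow_of_exponent_le one_le_two ?_
        have : ((a 2 : ℤ) : ℝ) ≤ j := by exact_mod_cast hj.1
        linarith
      have hpos : (0 : ℝ) < 2 ^ ((j : ℝ) / 2) := by positivity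
      have hb1 : 2 ^ ((j : ℝ) / 2) * (2 ^ ((j : ℝ) / 2) * layer s j) ≤
          2 ^ ((j : ℝ) / 2) * (2 * κ / Real.log n ^ 5) := by
        rw [← mul_assoc, ← hsplit]
        refine hj2.trans ?_
        rw [mul_assoc]
        refine (mul_le_mul_of_nonneg_left hlarge hκ).trans ?_
        have : 2 * (2 : ℝ) ^ (((a 2 : ℤ) : ℝ) / 2) / Real.log n ^ 5 ≤
            2 * 2 ^ ((j : ℝ) / 2) / Real.log n ^ 5 := by gcongr
        refine (mul_le_mul_of_nonneg_left this hκ).trans (le_of_eq ?_)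
        ring
      have := le_of_mul_le_mul_left hb1 hpos
      calc _ ≤ 2 * (2 * κ / Real.log n ^ 5) := by linarith
        _ = _ := by ring
    · rw [nsmul_eq_mul]
      refine (mul_le_mul_of_nonneg_right (card_Icc_le hn hlog ha0) (by positivity)).trans ?_
      have g : Real.log n / Real.log n ^ 5 ≤ 1 := by
        rw [div_le_one (by positivity)]
        exact le_self_pow₀ hlog (by norm_num)
      calc _ = 16 * κ * (Real.log n / Real.log n ^ 5) := by ring
        _ ≤ 16 * κ * √(Real.log n) := by
          refine mul_le_mul_of_nonneg_left (g.trans hsl) (by positivity)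
        _ = _ := by ring
  have middle : ∀ m, 2 ≤ m → m ≤ L → ∑ j ∈ Icc (a m) b, √((2 : ℝ) ^ (j + 1)) * layer s j ≤
      16 * (κ * √(Real.log n)) + 64 * (κ * √(Real.log n)) / y m := by
    intro m hm
    induction m, hm using Nat.le_induction with
    | base =>
      intro h
      have := hy1 2 h
      have : 0 ≤ 64 * (κ * √(Real.log n)) / y 2 := by positivity
      linarith
    | succ m hm ih =>
      intro hmL
      have ih := ih (by omega)
      have hym := hy1 m (by omega)
      have hym1 := hy1 (m + 1) hmL
      have h2y : 2 * y (m + 1) ≤ y m := two_mul_iterLog_succ_le (by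
        change 0 < y m
        linarith)
      have hsub : Icc (a (m + 1)) b ⊆ Icc (a (m + 1)) (a m) ∪ Icc (a m) b := by
        intro j hj
        simp only [mem_union, mem_Icc] at hj ⊢
        omega
      have hcard : (#(Icc (a (m + 1)) (a m)) : ℝ) ≤ 32 * y m := by
        have q1 := Int.floor_le (Real.logb 2 n + 30 * y m)
        have q2 := Int.lt_floor_add_one (Real.logb 2 n + 30 * y (m + 1))
        have q3 : a (m + 1) ≤ a m := Int.floor_le_floor (by linarith)
        rw [Int.card_Icc]
        have q4 : ((a m + 1 - a (m + 1)).toNat : ℤ) = a m + 1 - a (m + 1) :=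
          Int.toNat_of_nonneg (by omega)
        have q5 : ((a m + 1 - a (m + 1)).toNat : ℝ) = a m + 1 - a (m + 1) := by
          exact_mod_cast q4
        rw [q5]
        simp only [ha]
        linarith
      have hnew : ∑ j ∈ Icc (a (m + 1)) (a m), √((2 : ℝ) ^ (j + 1)) * layer s j ≤
          64 * (κ * √(Real.log n)) / y m := by
        refine (sum_le_card_nsmul _ _ (2 * (κ * √(Real.log n) / y m ^ 2)) fun j hj => ?_).trans ?_
        · rw [mem_Icc] at hj
          refine (hterm j).trans (mul_le_mul_of_nonneg_left ?_ zero_le_two)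
          exact h3 m hm hmL j hj.1 hj.2
        · rw [nsmul_eq_mul]
          refine (mul_le_mul_of_nonneg_right hcard (by positivity)).trans (le_of_eq ?_)
          field_simp
          ring
      have hdiv : 64 * (κ * √(Real.log n)) / y m + 64 * (κ * √(Real.log n)) / y m ≤
          64 * (κ * √(Real.log n)) / y (m + 1) := by
        rw [← add_div, div_le_div_iff₀ (by linarith) (by linarith)]
        have : 0 ≤ κ * √(Real.log n) := by positivity
        nlinarith
      have hun := sum_union_inter (s₁ := Icc (a (m + 1)) (a m)) (s₂ := Icc (a m) b)
        (f := fun j => √((2 : ℝ) ^ (j + 1)) * layer s j)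
      have hint : 0 ≤ ∑ j ∈ Icc (a (m + 1)) (a m) ∩ Icc (a m) b,
          √((2 : ℝ) ^ (j + 1)) * layer s j := sum_nonneg fun j _ => hterm0 j
      have := sum_le_sum_of_subset_of_nonneg hsub fun j _ _ => hterm0 j
      linarith
  have hmid := middle L hstar le_rfl
  have hlast : 64 * (κ * √(Real.log n)) / y L ≤ 64 * (κ * √(Real.log n)) :=
    div_le_self (by positivity) (hy1 L le_rfl)
  have hK : 0 ≤ κ * √(Real.log n) := by positivity
  calc _ ≤ _ := hlay
    _ ≤ 2 ^ 45 * (κ * √(Real.log n)) + (16 * (κ * √(Real.log n)) + 64 * (κ * √(Real.log n))) := by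
      linarith
    _ ≤ _ := by nlinarith

end Bounds

end BoolCube

namespace BoolCube

open Finset
open scoped BigOperators

lemma posSens_le_card {ι : Type*} [Fintype ι] [DecidableEq ι] (f : (ι → Bool) → Bool)
    (x : ι → Bool) : posSens f x ≤ Fintype.card ι := by
  unfold posSens
  split_ifs
  · exact Nat.zero_le _
  · exact card_le_univ _

lemma eventually_large : ∀ᶠ n : ℕ in Filter.atTop,
    32 ≤ Real.log n ∧ 2 * Real.log n ^ 9 ≤ (n : ℝ) ^ (1 / 8 : ℝ) := by
  have hlog : Filter.Tendsto (fun n : ℕ => Real.log n) Filter.atTop Filter.atTop :=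
    Real.tendsto_log_atTop.comp tendsto_natCast_atTop_atTop
  have hsmall := ((isLittleO_log_rpow_rpow_atTop (9 : ℝ) (show (0 : ℝ) < 1 / 8 by norm_num)).bound
    (show (0 : ℝ) < 1 / 2 by norm_num))
  filter_upwards [hlog.eventually_ge_atTop 32, tendsto_natCast_atTop_atTop.eventually hsmall]
    with n h1 h2
  refine ⟨h1, ?_⟩
  have h3 : Real.log n ^ (9 : ℝ) = Real.log n ^ 9 := by
    rw [← Real.rpow_natCast]; norm_num
  rw [h3, Real.norm_of_nonneg (by positivity), Real.norm_of_nonneg (by positivity)] at h2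
  linarith

/-- Choice of the degree separating low and high Fourier levels. -/
lemma exists_degree {n : ℕ} (hn : 2 ≤ n) (hlog : 32 ≤ Real.log n)
    (hpow : 2 * Real.log n ^ 9 ≤ (n : ℝ) ^ (1 / 8 : ℝ)) {ε E Λ : ℝ} (hε : 0 ≤ ε) (hε1 : ε ≤ 1)
    (hE0 : 0 ≤ E) (hE : E ≤ 9 * (1 / 2 ^ 53 * ε) * √n * Real.log n ^ 6)
    (hΛ : Λ ≤ 2 ^ 46 * (1 / 2 ^ 53 * ε) * √(Real.log n)) :
    ∃ d : ℕ, 1 ≤ d ∧ (n.choose 2 : ℕ) * (3 ^ d * (2 * E / (n.choose 2 : ℕ) *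
      √(2 * E / (n.choose 2 : ℕ))) / 4) + 4 * Λ / √d ≤ ε / 2 := by
  have hn0 : (0 : ℝ) < n := by exact_mod_cast (by omega : 0 < n)
  have hn2 : (2 : ℝ) ≤ n := by exact_mod_cast hn
  set l := Real.log n with hl
  set r := (n : ℝ) ^ (1 / 8 : ℝ) with hr
  set N : ℝ := ((n.choose 2 : ℕ) : ℝ) with hN
  have hr0 : 0 < r := by positivity
  have hr8 : r ^ 8 = n := by
    rw [hr, ← Real.rpow_natCast, ← Real.rpow_mul hn0.le]
    norm_num
  have hsn : √(n : ℝ) = r ^ 4 := by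
    rw [← hr8, show r ^ 8 = (r ^ 4) ^ 2 by ring, Real.sqrt_sq (by positivity)]
  have hN4 : r ^ 16 / 4 ≤ N := by
    rw [hN, Nat.cast_choose_two, show r ^ 16 = (r ^ 8) ^ 2 by ring, hr8]
    nlinarith
  have hN0 : 0 < N := lt_of_lt_of_le (by positivity) hN4
  have hd1 : l / 32 ≤ ⌊l / 16⌋₊ := by
    have := Nat.lt_floor_add_one (l / 16)
    linarith
  have hd2 : (⌊l / 16⌋₊ : ℝ) ≤ l / 16 := Nat.floor_le (by positivity)
  set d := ⌊l / 16⌋₊ with hd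
  have hdpos : (1 : ℝ) ≤ d := by linarith
  refine ⟨d, by exact_mod_cast hdpos, ?_⟩
  have h3d : (3 : ℝ) ^ d ≤ r := by
    have h3 : (3 : ℝ) ≤ Real.exp 2 := by linarith [Real.add_one_le_exp 2]
    calc (3 : ℝ) ^ d ≤ Real.exp 2 ^ d := pow_le_pow_left₀ (by norm_num) h3 d
      _ = Real.exp (d * 2) := (Real.exp_nat_mul 2 d).symm
      _ ≤ Real.exp (Real.log n * (1 / 8)) := Real.exp_le_exp.2 (by linarith)
      _ = r := (Real.rpow_def_of_pos hn0 _).symm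
  have hl0 : 0 < l := by linarith
  have h2E : 2 * E ≤ ε * (r ^ 4 * l ^ 6) := by
    rw [hsn] at hE
    have : 0 ≤ ε * (r ^ 4 * l ^ 6) := by positivity
    nlinarith
  have hp : 2 * E / N ≤ (2 * l ^ 3 / r ^ 6) ^ 2 := by
    rw [div_le_iff₀ hN0]
    calc 2 * E ≤ 1 * (r ^ 4 * l ^ 6) := h2E.trans (by gcongr)
      _ = (2 * l ^ 3 / r ^ 6) ^ 2 * (r ^ 16 / 4) := by field_simp; ring
      _ ≤ _ := by gcongr
  have hsp : √(2 * E / N) ≤ 2 * l ^ 3 / r ^ 6 := Real.sqrt_le_iff.2 ⟨by positivity, hp⟩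
  have low : N * (3 ^ d * (2 * E / N * √(2 * E / N)) / 4) ≤ ε / 4 := by
    calc N * (3 ^ d * (2 * E / N * √(2 * E / N)) / 4)
        = 3 ^ d * (2 * E * √(2 * E / N)) / 4 := by field_simp
      _ ≤ r * (ε * (r ^ 4 * l ^ 6) * (2 * l ^ 3 / r ^ 6)) / 4 := by gcongr
      _ = ε / 4 * (2 * l ^ 9 / r) := by field_simp
      _ ≤ ε / 4 * 1 := by
        gcongr
        rw [div_le_one hr0]
        exact hpow
      _ = ε / 4 := mul_one _
  have high : 4 * Λ / √d ≤ ε / 4 := by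
    have hsd : 0 < √(d : ℝ) := by positivity
    have hsl : √l ≤ 8 * √d := by
      refine Real.sqrt_le_iff.2 ⟨by positivity, ?_⟩
      rw [mul_pow, Real.sq_sqrt (by positivity)]
      linarith
    rw [div_le_iff₀ hsd]
    have := mul_le_mul_of_nonneg_left hsl 
      (mul_nonneg (show (0 : ℝ) ≤ 1 / 128 by norm_num) hε)
    linarith
  linarith

end BoolCube

/-- trichotomy for symmetric Boolean graph functions. -/
theorem symmetric_sensitivity_trichotomy :
    ∃ c : ℝ, 0 < c ∧ ∃ n₀ : ℕ, ∀ n : ℕ, n₀ ≤ n →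
      ∀ ε : ℝ, 0 < ε → ε ≤ 1 / 4 →
      ∀ f : SimpleGraph (Fin n) → Bool,
        (∀ σ : Equiv.Perm (Fin n), ∀ G : SimpleGraph (Fin n),
          f (G.map σ.toEmbedding) = f G) →
        graphProb n (fun G => f G = true) ∈ Set.Icc ε (1 - ε) →
        -- Inf1
        (c * ε * Real.sqrt (Real.log n / n)
            ≤ graphProb n (fun G => 0 < gPosSens f G)) ∨
        -- Inf2
        (∃ j : ℤ, ⌊Real.logb 2 n / 2⌋ ≤ j ∧ j ≤ ⌊Real.logb 2 (n.choose 2)⌋ ∧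
          c * ε * Real.sqrt n * Real.log n ^ 5 ≤
            (2 : ℝ) ^ j *
              graphProb n (fun G =>
                (gPosSens f G : ℝ) ∈ Set.Icc ((2 : ℝ) ^ j) ((2 : ℝ) ^ (j + 1)))) ∨
        -- Inf3
        (∃ ℓ : ℕ, 2 ≤ ℓ ∧ ℓ + 1 ≤ logStar n ∧ ∃ j : ℤ,
          ⌊Real.logb 2 n + 30 * iterLog (ℓ + 1) n⌋ ≤ j ∧
          j ≤ ⌊Real.logb 2 n + 30 * iterLog ℓ n⌋ ∧
          c * ε * Real.sqrt (Real.log n) / (iterLog ℓ n) ^ 2 ≤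
            (2 : ℝ) ^ ((j : ℝ) / 2) *
              graphProb n (fun G =>
                (gPosSens f G : ℝ) ∈ Set.Icc ((2 : ℝ) ^ j) ((2 : ℝ) ^ (j + 1)))) := by
  obtain ⟨n₀, hn₀⟩ := Filter.eventually_atTop.1 BoolCube.eventually_large
  refine ⟨1 / 2 ^ 53, by positivity, n₀, fun n hn ε hε hε4 f hf hE => ?_⟩
  obtain ⟨hlog, hpow⟩ := hn₀ n hn
  have hn2 : 2 ≤ n := by
    by_contra! h
    have : Real.log n ≤ 0 := Real.log_nonpos (by positivity) (by exact_mod_cast (by omega : n ≤ 1))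
    linarith
  have hn1 : (1 : ℝ) ≤ n := by exact_mod_cast (by omega : 1 ≤ n)
  by_contra! hcon
  obtain ⟨c1, c2, c3⟩ := hcon
  set s := BoolCube.posSens (BoolCube.onCube f) with hs
  have hsN : ∀ x, s x ≤ n.choose 2 := fun x => by
    rw [← BoolCube.card_slot]
    exact BoolCube.posSens_le_card _ x
  have hpos : graphProb n (fun G => 0 < gPosSens f G) = BoolCube.probPos s := by
    simp_rw [BoolCube.graphProb_eq, BoolCube.gPosSens_toGraph]
    rfl
  have hlayer : ∀ j : ℤ, graphProb n (fun G =>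
      (gPosSens f G : ℝ) ∈ Set.Icc ((2 : ℝ) ^ j) ((2 : ℝ) ^ (j + 1))) = BoolCube.layer s j := by
    intro j
    simp_rw [BoolCube.graphProb_eq, BoolCube.gPosSens_toGraph]
    rfl
  simp only [hpos] at c1
  simp only [hlayer] at c2 c3
  have hκ : 0 ≤ 1 / 2 ^ 53 * ε := by positivity
  have hstar : 2 ≤ logStar n := by
    by_contra! h
    have hmem := BoolCube.iterLog_logStar_mem hn1
    have h1 : Real.exp 1 ≤ Real.log n := by linarith [Real.exp_one_lt_d9]
    interval_cases hl : logStar n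
    · have := hmem.2
      simp only [iterLog] at this
      linarith [Real.log_le_sub_one_of_pos (by linarith : (0 : ℝ) < n)]
    · exact absurd hmem.2 (not_lt.2 h1)
  have hEs := BoolCube.expect_le_of_layers s hn2 (by linarith) hsN hκ c1.le
    fun j h1 h2 => (c2 j h1 h2).le
  have hΛ := BoolCube.expect_sqrt_le_of_layers s hn2 (by linarith) hstar hsN hκ c1.le
    (fun j h1 h2 => (c2 j h1 h2).le) fun ℓ h1 h2 j h3 h4 => (c3 ℓ h1 h2 j h3 h4).le
  obtain ⟨d, hd, hbound⟩ := BoolCube.exists_degree hn2 hlog hpow hε.le (by linarith)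
    (Finset.expect_nonneg fun x _ => Nat.cast_nonneg (s x)) hEs hΛ
  have hvar := BoolCube.graph_variance_le f hf hn2 hd rfl
  obtain ⟨hE1, hE2⟩ := hE
  nlinarith [hvar.trans hbound]
end

section
/- There exists an absolute constant C > 0 such that for every even integer n ≥ 2 and every real t with n/2 + t ∈ {0,1,…,n} and |t| ≤ n^{4/5}: C(n, n/2+t) / C(n, n/2) = exp(−2t²/n − 4t⁴/(3n³)) · (1 + E) for some real E with |E| ≤ C·(1/n + t²/n² + t⁶/n⁵). -/
open Real in
theorem abs_log_one_sub_sub_log_one_add_le {y : ℝ} (h0 : 0 ≤ y) (h : y ≤ 1 / 2) :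
    |log (1 - y) - log (1 + y) + 2 * y + 2 * y ^ 3 / 3| ≤ 4 * y ^ 5 := by
  have bound : y ^ 5 / (1 - y) ≤ 2 * y ^ 5 := by
    rw [div_le_iff₀ (by linarith)]
    nlinarith [pow_nonneg h0 5]
  have h1 := abs_log_sub_add_sum_range_le (x := y) (by rw [abs_of_nonneg h0]; linarith) 4
  have h2 := abs_log_sub_add_sum_range_le (x := -y)
    (by rw [abs_neg, abs_of_nonneg h0]; linarith) 4
  rw [abs_neg] at h2
  rw [abs_of_nonneg h0] at h1 h2
  simp only [Finset.sum_range_succ, Finset.sum_range_zero] at h1 h2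
  norm_num at h1 h2
  rw [abs_le] at *
  ring_nf at h1 h2 bound ⊢
  constructor <;> linarith [h1.1, h1.2, h2.1, h2.2]

open Real in
/-- The logarithm of a ratio of binomial coefficients, expanded around the half-integer
`N + 1 / 2`, at which consecutive ratios are symmetric. -/
theorem abs_log_centralBinom_ratio_shifted_le (N k : ℕ) (hk : 2 * k ≤ N) :
    |log ((2 * N).choose (N + k)) - log ((2 * N).choose N) + k ^ 2 / (N + 1 / 2 : ℝ)
        + (2 * k ^ 4 - k ^ 2) / (12 * (N + 1 / 2 : ℝ) ^ 3)|
      ≤ 4 * k ^ 6 / (N + 1 / 2 : ℝ) ^ 5 := by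
  induction k with
  | zero => simp
  | succ k ih =>
    have ih := ih (by omega)
    have hkN : (2 * (k + 1) : ℝ) ≤ N := by exact_mod_cast hk
    have hk0 : (0 : ℝ) ≤ k := k.cast_nonneg
    set M : ℝ := N + 1 / 2 with hM
    have hM0 : 0 < M := by positivity
    have hy : (k + 1 / 2) / M ≤ 1 / 2 := by
      rw [div_le_iff₀ hM0]; linarith
    have key := abs_log_one_sub_sub_log_one_add_le (by positivity) hy
    have hrec : ((2 * N).choose (N + (k + 1)) : ℝ) * (N + k + 1)
        = (2 * N).choose (N + k) * (N - k) := by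
      have h := Nat.choose_succ_right_eq (2 * N) (N + k)
      rw [show 2 * N - (N + k) = N - k by omega] at h
      have h' := congrArg (Nat.cast (R := ℝ)) h
      push_cast [Nat.cast_sub (show k ≤ N by omega)] at h'
      rw [← add_assoc, ← h']
    have hpos (j : ℕ) (hj : j ≤ 2 * N) : ((2 * N).choose j : ℝ) ≠ 0 := by
      exact_mod_cast (Nat.choose_pos hj).ne'
    have e1 : 1 - (k + 1 / 2) / M = (N - k) / M := by
      rw [eq_div_iff hM0.ne', sub_mul, div_mul_cancel₀ _ hM0.ne']; rw [hM]; ring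
    have e2 : 1 + (k + 1 / 2) / M = (N + k + 1) / M := by
      rw [eq_div_iff hM0.ne', add_mul, div_mul_cancel₀ _ hM0.ne']; rw [hM]; ring
    have hNk : (N - k : ℝ) ≠ 0 := by linarith
    have hlog := congrArg log hrec
    rw [log_mul (hpos _ (by omega)) (by positivity), log_mul (hpos _ (by omega)) hNk] at hlog
    rw [e1, e2, log_div hNk hM0.ne', log_div (by positivity) hM0.ne'] at key
    have hpow : 4 * (k : ℝ) ^ 6 / M ^ 5 + 4 * ((k + 1 / 2) / M) ^ 5
        ≤ 4 * (k + 1) ^ 6 / M ^ 5 := by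
      rw [div_pow, mul_div_assoc', ← add_div]
      gcongr
      have : (0 : ℝ) ≤ 4 * (k + 1) ^ 6 - (4 * k ^ 6 + 4 * (k + 1 / 2) ^ 5) := by
        ring_nf
        positivity
      linarith
    push_cast
    refine le_trans (le_trans (le_of_eq ?_) (abs_add_le _ _)) (le_trans (add_le_add ih key) hpow)
    congr 1
    have hl : log ((2 * N).choose (N + (k + 1))) = log ((2 * N).choose (N + k))
        + log (N - k) - log (N + k + 1) := by linarith
    rw [hl]
    field_simp
    ring

open Real in
theorem abs_log_centralBinom_ratio_le (N k : ℕ) (hN : 0 < N) (hk : 2 * k ≤ N) :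
    |log ((2 * N).choose (N + k)) - log ((2 * N).choose N) + k ^ 2 / (N : ℝ)
        + k ^ 4 / (6 * (N : ℝ) ^ 3)|
      ≤ 4 * k ^ 6 / (N : ℝ) ^ 5 + 3 * (k ^ 2 / (N : ℝ) ^ 2) := by
  have main := abs_log_centralBinom_ratio_shifted_le N k hk
  have hN1 : (1 : ℝ) ≤ N := by exact_mod_cast hN
  have hkN : (k : ℝ) ≤ N := by exact_mod_cast (by omega : k ≤ N)
  have hk0 : (0 : ℝ) ≤ k := k.cast_nonneg
  generalize (N : ℝ) = x at *
  generalize (k : ℝ) = z at *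
  have hx : 0 < x := by linarith
  have h6 : 4 * z ^ 6 / (x + 1 / 2) ^ 5 ≤ 4 * z ^ 6 / x ^ 5 := by gcongr; linarith
  have inv_diff : 1 / x - 1 / (x + 1 / 2) ≤ 1 / x ^ 2 := by
    rw [div_sub_div _ _ (by positivity) (by positivity),
      div_le_div_iff₀ (by positivity) (by positivity)]
    nlinarith [pow_pos hx 2]
  have inv_diff_nonneg : 0 ≤ 1 / x - 1 / (x + 1 / 2) := by
    rw [sub_nonneg]; gcongr; linarith
  have inv_cube_diff : 1 / x ^ 3 - 1 / (x + 1 / 2) ^ 3 ≤ 6 / x ^ 4 := by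
    rw [div_sub_div _ _ (by positivity) (by positivity),
      div_le_div_iff₀ (by positivity) (by positivity), ← sub_nonneg]
    ring_nf
    positivity
  have inv_cube_diff_nonneg : 0 ≤ 1 / x ^ 3 - 1 / (x + 1 / 2) ^ 3 := by
    rw [sub_nonneg]; gcongr; linarith
  have inv_cube : 1 / (x + 1 / 2) ^ 3 ≤ 1 / x ^ 2 := by
    gcongr 1 / ?_
    nlinarith [pow_pos hx 2, pow_pos hx 3]
  have quartic : z ^ 4 / x ^ 4 ≤ z ^ 2 / x ^ 2 := by
    rw [div_le_div_iff₀ (by positivity) (by positivity)]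
    have : z ^ 2 ≤ x ^ 2 := by gcongr
    nlinarith [mul_le_mul_of_nonneg_left this (by positivity : 0 ≤ z ^ 2 * x ^ 2)]
  have b1 := mul_le_mul_of_nonneg_left inv_diff (sq_nonneg z)
  have b1' := mul_nonneg (sq_nonneg z) inv_diff_nonneg
  have b2 := mul_le_mul_of_nonneg_left inv_cube_diff (by positivity : 0 ≤ z ^ 4 / 6)
  have b2' := mul_nonneg (by positivity : 0 ≤ z ^ 4 / 6) inv_cube_diff_nonneg
  have b3 := mul_le_mul_of_nonneg_left inv_cube (by positivity : 0 ≤ z ^ 2 / 12)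
  have b3' : 0 ≤ z ^ 2 / 12 * (1 / (x + 1 / 2) ^ 3) := by positivity
  have sq_nn : 0 ≤ z ^ 2 / x ^ 2 := by positivity
  have r1 : z ^ 2 / x = z ^ 2 * (1 / x - 1 / (x + 1 / 2)) + z ^ 2 / (x + 1 / 2) := by ring
  have r2 : z ^ 4 / (6 * x ^ 3) = z ^ 4 / 6 * (1 / x ^ 3 - 1 / (x + 1 / 2) ^ 3)
      + (2 * z ^ 4 - z ^ 2) / (12 * (x + 1 / 2) ^ 3)
      + z ^ 2 / 12 * (1 / (x + 1 / 2) ^ 3) := by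
    field_simp
    ring
  have s1 : z ^ 2 * (1 / x ^ 2) = z ^ 2 / x ^ 2 := by ring
  have s2 : z ^ 4 / 6 * (6 / x ^ 4) = z ^ 4 / x ^ 4 := by ring
  have s3 : z ^ 2 / 12 * (1 / x ^ 2) = z ^ 2 / x ^ 2 / 12 := by ring
  rw [r1, r2]
  rw [abs_le] at *
  constructor <;> linarith [main.1, main.2]

theorem Real.abs_exp_sub_one_le_mul_exp_abs (x : ℝ) : |exp x - 1| ≤ |x| * exp |x| := by
  rcases le_total 0 x with hx | hx
  · rw [abs_of_nonneg hx, abs_of_nonneg (by linarith [add_one_le_exp x])]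
    have := mul_le_mul_of_nonneg_right (one_sub_le_exp_neg x) (exp_pos x).le
    rw [← exp_add, neg_add_cancel, exp_zero] at this
    linarith
  · rw [abs_of_nonpos hx, abs_of_nonpos (by linarith [exp_le_one_iff.2 hx])]
    nlinarith [add_one_le_exp x, one_le_exp (neg_nonneg.2 hx)]

/-- Both signs of the deviation `t` reduce to a natural number by the symmetry of the binomial
coefficients. -/
theorem exists_choose_eq_choose_add {N m : ℕ} (hm : m ≤ 2 * N) :
    ∃ k ≤ N, (2 * N).choose m = (2 * N).choose (N + k) ∧ (k : ℝ) = |(m : ℝ) - N| := by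
  rcases le_total N m with h | h
  · refine ⟨m - N, by omega, by rw [Nat.add_sub_cancel' h], ?_⟩
    rw [Nat.cast_sub h, abs_of_nonneg (sub_nonneg.2 (by exact_mod_cast h))]
  · refine ⟨N - m, by omega, ?_, ?_⟩
    · rw [← Nat.choose_symm hm]
      congr 1
      omega
    · rw [Nat.cast_sub h, abs_of_nonpos (sub_nonpos.2 (by exact_mod_cast h))]
      ring

theorem lt_of_div_four_lt_rpow {x : ℝ} (hx : 0 < x) (h : x / 4 < x ^ ((4 : ℝ) / 5)) :
    x < 1024 := by
  have h5 : (x / 4) ^ 5 < (x ^ ((4 : ℝ) / 5)) ^ 5 := by gcongr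
  rw [← Real.rpow_mul_natCast hx.le, show (4 : ℝ) / 5 * (5 : ℕ) = (4 : ℕ) by norm_num,
    Real.rpow_natCast] at h5
  have : x ^ 4 * x < x ^ 4 * 1024 := by linarith
  exact lt_of_mul_lt_mul_left this (by positivity)

theorem pow_six_div_pow_five_le_one {x z : ℝ} (hx : 1 ≤ x) (hz : 0 ≤ z)
    (h : z ≤ x ^ ((4 : ℝ) / 5)) : z ^ 6 / x ^ 5 ≤ 1 := by
  rw [div_le_one (by positivity)]
  calc z ^ 6 ≤ (x ^ ((4 : ℝ) / 5)) ^ 6 := by gcongr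
    _ = x ^ ((24 : ℝ) / 5) := by
      rw [← Real.rpow_mul_natCast (by positivity)]; norm_num
    _ ≤ x ^ ((5 : ℕ) : ℝ) := Real.rpow_le_rpow_of_exponent_le hx (by norm_num)
    _ = x ^ 5 := Real.rpow_natCast x 5


/-- There is an absolute constant `C > 0` such that for every even
`n ≥ 2` and real `t` with `n/2 + t ∈ {0,…,n}` and `|t| ≤ n^{4/5}`:
`C(n, n/2+t) / C(n, n/2) = exp(−2t²/n − 4t⁴/(3n³)) · (1 + E)` with
`|E| ≤ C · (1/n + t²/n² + t⁶/n⁵)`. -/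
theorem binom_ratio_near_middle :
    ∃ C : ℝ, 0 < C ∧
      ∀ n : ℕ, 2 ≤ n → Even n → ∀ t : ℝ, ∀ m : ℕ, m ≤ n →
        (m : ℝ) = (n : ℝ) / 2 + t → |t| ≤ (n : ℝ) ^ ((4 : ℝ) / 5) →
        ∃ E : ℝ, |E| ≤ C * (1 / n + t ^ 2 / (n : ℝ) ^ 2 + t ^ 6 / (n : ℝ) ^ 5) ∧
          (n.choose m : ℝ) / (n.choose (n / 2) : ℝ)
            = Real.exp (-(2 * t ^ 2) / n - 4 * t ^ 4 / (3 * (n : ℝ) ^ 3)) * (1 + E) := by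
  refine ⟨128 * Real.exp 384 + 1024 * Real.exp 1024, by positivity, ?_⟩
  intro n hn heven t m hm hmt ht
  obtain ⟨N, rfl⟩ := heven.two_dvd
  obtain ⟨k, hkN, hchoose, hk⟩ := exists_choose_eq_choose_add hm
  have hx2 : (2 : ℝ) ≤ (2 * N : ℕ) := by exact_mod_cast hn
  have hNx : (N : ℝ) = (2 * N : ℕ) / 2 := by push_cast; ring
  rw [Nat.mul_div_cancel_left N two_pos, hchoose]
  have htk : |t| = k := by rw [hk, hmt, hNx]; congr 1; ring
  have t2 : t ^ 2 = k ^ 2 := by rw [← htk, sq_abs]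
  have t4 : t ^ 4 = k ^ 4 := by linear_combination (t ^ 2 + k ^ 2) * t2
  have t6 : t ^ 6 = k ^ 6 := by linear_combination (t ^ 4 + t ^ 2 * k ^ 2 + k ^ 4) * t2
  rw [htk] at ht
  rw [t2, t4, t6]
  have hkx : (k : ℝ) ≤ (2 * N : ℕ) / 2 := by rw [← hNx]; exact_mod_cast hkN
  have hA : (0 : ℝ) < (2 * N).choose (N + k) := by
    exact_mod_cast Nat.choose_pos (by omega)
  have hB : (0 : ℝ) < (2 * N).choose N := by
    exact_mod_cast Nat.choose_pos (by omega)
  have hAB : ((2 * N).choose (N + k) : ℝ) ≤ (2 * N).choose N := by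
    exact_mod_cast Nat.choose_le_centralBinom (N + k) N
  have hlog := abs_log_centralBinom_ratio_le N k (by omega)
  have hcast : (2 * k ≤ N) ↔ (k : ℝ) ≤ (2 * N : ℕ) / 4 := by
    rw [le_div_iff₀ (by norm_num)]
    norm_cast
    omega
  rw [hcast, hNx] at hlog
  clear hcast hNx hmt htk t2 t4 t6 hk hkN hchoose
  have hk0 : (0 : ℝ) ≤ k := k.cast_nonneg
  generalize ((2 * N).choose (N + k) : ℝ) = A at *
  generalize ((2 * N).choose N : ℝ) = B at *
  generalize ((2 * N : ℕ) : ℝ) = x at *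
  generalize (k : ℝ) = z at *
  have hx : 0 < x := by linarith
  set ε := 1 / x + z ^ 2 / x ^ 2 + z ^ 6 / x ^ 5 with hε
  have h6 : 0 ≤ z ^ 6 / x ^ 5 := by positivity
  have h2 : 0 ≤ z ^ 2 / x ^ 2 := by positivity
  have h1 : 0 ≤ 1 / x := by positivity
  have hε0 : 0 ≤ ε := by positivity
  set P := -(2 * z ^ 2) / x - 4 * z ^ 4 / (3 * x ^ 3) with hP
  refine ⟨A / B * Real.exp (-P) - 1, ?_, ?_⟩
  · by_cases hz : z ≤ x / 4
    · have hδ : |Real.log A - Real.log B - P| ≤ 128 * ε := by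
        refine le_trans (le_of_eq ?_) ((hlog hz).trans ?_)
        · congr 1
          rw [hP]
          field_simp
          ring
        · have e6 : 4 * z ^ 6 / (x / 2) ^ 5 = 128 * (z ^ 6 / x ^ 5) := by ring
          have e2 : z ^ 2 / (x / 2) ^ 2 = 4 * (z ^ 2 / x ^ 2) := by ring
          rw [e6, e2]
          linarith
      have hε3 : ε ≤ 3 := by
        have := pow_six_div_pow_five_le_one (by linarith) hk0 ht
        have : z ^ 2 / x ^ 2 ≤ 1 := by
          rw [div_le_one (by positivity)]; gcongr; linarith
        have : 1 / x ≤ 1 := by rw [div_le_one hx]; linarith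
        linarith
      have hexp : A / B * Real.exp (-P) = Real.exp (Real.log A - Real.log B - P) := by
        rw [sub_eq_add_neg _ P, Real.exp_add, Real.exp_sub, Real.exp_log hA, Real.exp_log hB]
      rw [hexp]
      calc _ ≤ _ := Real.abs_exp_sub_one_le_mul_exp_abs _
        _ ≤ 128 * ε * Real.exp 384 := by gcongr; linarith
        _ ≤ _ := by nlinarith [mul_nonneg hε0 (Real.exp_pos 1024).le]
    · have hx1024 := lt_of_div_four_lt_rpow hx ((not_le.1 hz).trans_le ht)
      have hPx : -P ≤ x := by
        have p2 : 2 * z ^ 2 / x ≤ 2 * (x / 2) ^ 2 / x := by gcongr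
        have p4 : 4 * z ^ 4 / (3 * x ^ 3) ≤ 4 * (x / 2) ^ 4 / (3 * x ^ 3) := by gcongr
        have q2 : 2 * (x / 2) ^ 2 / x = x / 2 := by field_simp
        have q4 : 4 * (x / 2) ^ 4 / (3 * x ^ 3) = x / 12 := by field_simp; norm_num
        rw [hP, neg_div]
        linarith
      have hR : A / B ≤ 1 := (div_le_one hB).2 hAB
      have hR0 : 0 ≤ A / B := by positivity
      have hE : A / B * Real.exp (-P) ≤ 1 * Real.exp 1024 := by gcongr; linarith
      have hE0 : 0 ≤ A / B * Real.exp (-P) := by positivity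
      have hε1 : 1 ≤ 1024 * ε := by
        have : 1 / 1024 ≤ 1 / x := by gcongr
        linarith
      have hC : Real.exp 1024 ≤ 1024 * Real.exp 1024 * ε := by
        nlinarith [Real.exp_pos 1024]
      have : 0 ≤ 128 * Real.exp 384 * ε := by positivity
      have : 1 ≤ Real.exp 1024 := Real.one_le_exp (by norm_num)
      rw [abs_le]
      constructor <;> linarith
  · rw [add_sub_cancel, mul_left_comm, ← Real.exp_add, add_neg_cancel, Real.exp_zero, mul_one]
end
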